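/- arXiv:2508.17438 — 5 statements merged into one kernel-verified Lean document; each statement's English description precedes it below -/
import Mathlib

section
/- Let G be a 2-connected finite simple graph, let X and Y be longest cycles of G, and let A ⊆ V(G) be a set that separates V(X) and V(Y), i.e., every (V(X), V(Y))-path in G contains a vertex of A. Then A is a transversal of G: every longest cycle Z of G satisfies V(Z) ∩ A ≠ ∅. -/
open SimpleGraph

/-- `X` is a longest cycle in `G`. -/
def IsLongestCycle {V : Type*} (G : SimpleGraph V) {x : V} (X : G.Walk x x) : Prop :=
  X.IsCycle ∧ ∀ (y : V) (W : G.Walk y y), W.IsCycle → W.length ≤ X.length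

/-- `p` is an `(A,B)`-path: a path meeting `A` exactly in its first vertex and `B` exactly
in its last vertex. -/
def IsABPath {V : Type*} (G : SimpleGraph V) (A B : Set V) {a b : V} (p : G.Walk a b) : Prop :=
  p.IsPath ∧ a ∈ A ∧ b ∈ B ∧ (∀ v ∈ p.support, v ∈ A → v = a) ∧
    (∀ v ∈ p.support, v ∈ B → v = b)

/-- `S` separates `A` and `B` in `G`: every `(A,B)`-path contains a vertex of `S`. -/
def Separates {V : Type*} (G : SimpleGraph V) (A B S : Set V) : Prop :=
  ∀ ⦃a b : V⦄ (p : G.Walk a b), IsABPath G A B p → ∃ v ∈ p.support, v ∈ S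

/-- `G` is `k`-connected: it has more than `k` vertices and remains connected after
deleting any set of fewer than `k` vertices. -/
def IsKConnected {V : Type*} [Fintype V] (G : SimpleGraph V) (k : ℕ) : Prop :=
  k < Fintype.card V ∧
    ∀ S : Finset V, S.card < k → ((⊤ : G.Subgraph).deleteVerts ↑S).coe.Connected

theorem aux_first_hit {V : Type*} {G : SimpleGraph V} (S : Set V) {u w : V} (p : G.Walk u w)
    (hw : w ∈ S) : ∃ (s : V) (q : G.Walk u s), s ∈ S ∧ (∀ v ∈ q.support, v ∈ p.support) ∧
      (∀ v ∈ q.support, v ∈ S → v = s) := by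
  induction p with
  | nil => exact ⟨_, Walk.nil, hw, by simp, by simp⟩
  | @cons a b c h p ih =>
    by_cases ha : a ∈ S
    · exact ⟨a, Walk.nil, ha, by simp, by simp⟩
    · obtain ⟨s, q, hs, h1, h2⟩ := ih hw
      refine ⟨s, Walk.cons h q, hs, ?_, ?_⟩
      · intro v hv
        simp only [Walk.support_cons, List.mem_cons] at hv ⊢
        exact hv.imp id (h1 v)
      · intro v hv hvS
        simp only [Walk.support_cons, List.mem_cons] at hv
        rcases hv with rfl | hv
        · exact absurd hvS ha
        · exact h2 v hv hvS

theorem aux_abpath {V : Type*} [DecidableEq V] {G : SimpleGraph V} (A B : Set V) {a b : V}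
    (p : G.Walk a b) (ha : a ∈ A) (hb : b ∈ B) :
    ∃ (a' b' : V) (q : G.Walk a' b'), IsABPath G A B q ∧ (∀ v ∈ q.support, v ∈ p.support) := by
  obtain ⟨b', q, hb', h1, h2⟩ := aux_first_hit B p hb
  obtain ⟨a', r, ha', h3, h4⟩ := aux_first_hit A q.reverse ha
  have hs : ∀ v ∈ r.reverse.bypass.support, v ∈ r.support := by
    intro v hv
    have := r.reverse.support_bypass_subset_support hv
    simpa using this
  have hq : ∀ v ∈ r.support, v ∈ q.support := by
    intro v hv
    simpa using h3 v hv
  exact ⟨a', b', r.reverse.bypass, ⟨Walk.bypass_isPath _, ha', hb',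
    fun v hv => h4 v (hs v hv), fun v hv => h2 v (hq v (hs v hv))⟩,
    fun v hv => h1 v (hq v (hs v hv))⟩

theorem aux_append {V : Type*} {G : SimpleGraph V} {a b c : V} {p : G.Walk a b} {q : G.Walk b c}
    (hp : p.IsPath) (hq : q.IsPath) (h : ∀ v ∈ p.support, v ∈ q.support → v = b) :
    (p.append q).IsPath := by
  rw [Walk.isPath_def, Walk.support_append, List.nodup_append']
  refine ⟨hp.support_nodup, hq.support_nodup.tail, ?_⟩
  intro v hv hv'
  have := h v hv (List.mem_of_mem_tail hv')
  subst this
  have h2 := hq.support_nodup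
  rw [← Walk.cons_tail_support, List.nodup_cons] at h2
  exact h2.1 hv'

theorem aux_arc {V : Type*} [DecidableEq V] {G : SimpleGraph V} {x : V} (X : G.Walk x x)
    (hX : X.IsCycle) {a b : V} (ha : a ∈ X.support) (hb : b ∈ X.support) (hab : a ≠ b) :
    ∃ p : G.Walk a b, p.IsPath ∧ (∀ v ∈ p.support, v ∈ X.support) ∧ X.length ≤ 2 * p.length := by
  have hc := hX.rotate ha
  have hl := X.length_rotate a ha
  have hs := fun v => (X.mem_support_rotate_iff (w := v) a ha)
  have hb' := (hs b).2 hb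
  obtain ⟨q, r, hqr⟩ := Walk.mem_support_iff_exists_append.mp hb'
  rw [hqr] at hc hl
  have hq := hc.isPath_of_append_left (Walk.not_nil_of_ne hab.symm)
  have hr := hc.isPath_of_append_right (Walk.not_nil_of_ne hab)
  rw [Walk.length_append] at hl
  by_cases hle : r.length ≤ q.length
  · refine ⟨q, hq, fun v hv => (hs v).1 ?_, by omega⟩
    rw [hqr, Walk.mem_support_append_iff]; exact Or.inl hv
  · refine ⟨r.reverse, hr.reverse, fun v hv => (hs v).1 ?_, by simp; omega⟩
    rw [hqr, Walk.mem_support_append_iff]; exact Or.inr (by simpa using hv)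

theorem aux_avoid {V : Type*} [Fintype V] [DecidableEq V] {G : SimpleGraph V}
    (h2 : IsKConnected G 2) {v a b : V} (ha : a ≠ v) (hb : b ≠ v) :
    ∃ p : G.Walk a b, v ∉ p.support := by
  have hc := h2.2 {v} (by simp)
  obtain ⟨w⟩ := hc.preconnected ⟨a, by simpa using ha⟩ ⟨b, by simpa using hb⟩
  refine ⟨w.map (Subgraph.hom _), ?_⟩
  intro hv
  have hv' := (List.mem_map.mp ((Walk.support_map (Subgraph.hom _) w) ▸ hv :
    v ∈ w.support.map (Subgraph.hom _)))
  obtain ⟨⟨c, hc⟩, -, h⟩ := hv'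
  simp at hc h
  exact hc h

/-- Two vertex-disjoint walks from `u` and `v` to `S`. -/
def AuxT {V : Type*} (G : SimpleGraph V) (S : Set V) (u v : V) : Prop :=
  ∃ (a b : V) (p : G.Walk u a) (q : G.Walk v b), a ∈ S ∧ b ∈ S ∧ ∀ t ∈ p.support, t ∉ q.support

theorem aux_step {V : Type*} [Fintype V] [DecidableEq V] {G : SimpleGraph V}
    (h2 : IsKConnected G 2) {S : Set V} {u v w : V} (huv : G.Adj u v) (hvw : G.Adj v w)
    (h : AuxT G S u v) : AuxT G S v w := by
  obtain ⟨a, b, p, q0, ha, hb, hd0⟩ := h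
  obtain ⟨q, hqp, hd⟩ : ∃ q : G.Walk v b, q.IsPath ∧ ∀ t ∈ p.support, t ∉ q.support :=
    ⟨q0.bypass, q0.bypass_isPath, fun t ht h => hd0 t ht (q0.support_bypass_subset_support h)⟩
  have hav : a ≠ v := by
    rintro rfl
    exact hd _ p.end_mem_support q.start_mem_support
  obtain ⟨r, hr⟩ := aux_avoid h2 hvw.ne' hav
  obtain ⟨s, r', hs, h3, h4⟩ := aux_first_hit
    (S ∪ {t | t ∈ p.support} ∪ {t | t ∈ q.support}) r (Or.inl (Or.inl ha))
  have hvr' : v ∉ r'.support := fun h => hr (h3 _ h)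
  have hsv : s ≠ v := by
    rintro rfl
    exact hvr' r'.end_mem_support
  by_cases hsp : s ∈ p.support
  · obtain ⟨p1, p2, hp⟩ := Walk.mem_support_iff_exists_append.mp hsp
    refine ⟨b, a, q, r'.append p2, hb, ha, ?_⟩
    intro t htq ht
    rw [Walk.mem_support_append_iff] at ht
    rcases ht with ht | ht
    · have := h4 t ht (Or.inr htq)
      subst this
      exact hd _ hsp htq
    · refine hd t ?_ htq
      rw [hp, Walk.mem_support_append_iff]; exact Or.inr ht
  by_cases hsq : s ∈ q.support
  · have hq' : ∃ q2 : G.Walk s b, (∀ t ∈ q2.support, t ∈ q.support) ∧ v ∉ q2.support := by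
      obtain ⟨q1, q2, hq⟩ := Walk.mem_support_iff_exists_append.mp hsq
      rw [hq] at hqp
      refine ⟨q2, fun t ht => ?_, ?_⟩
      · rw [hq, Walk.mem_support_append_iff]; exact Or.inr ht
      · intro hv
        exact hqp.ne_of_mem_support_of_append hsv.symm q1.start_mem_support hv rfl
    obtain ⟨q2, hq2, hvq2⟩ := hq'
    refine ⟨a, b, Walk.cons huv.symm p, r'.append q2, ha, hb, ?_⟩
    intro t ht ht'
    rw [Walk.support_cons, List.mem_cons] at ht
    rw [Walk.mem_support_append_iff] at ht'
    rcases ht with rfl | ht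
    · exact ht'.elim hvr' hvq2
    · rcases ht' with ht' | ht'
      · have := h4 t ht' (Or.inl (Or.inr ht))
        subst this
        exact hsp ht
      · exact hd t ht (hq2 t ht')
  · have hsS : s ∈ S := by
      rcases hs with (hs | hs) | hs
      · exact hs
      · exact absurd hs hsp
      · exact absurd hs hsq
    refine ⟨b, s, q, r', hb, hsS, ?_⟩
    intro t ht ht'
    have := h4 t ht' (Or.inr ht)
    subst this
    exact hsq ht

theorem aux_walk {V : Type*} [Fintype V] [DecidableEq V] {G : SimpleGraph V}
    (h2 : IsKConnected G 2) {S : Set V} {v t : V} (p : G.Walk v t) :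
    (∃ u, G.Adj u v ∧ AuxT G S u v) → ∃ u, G.Adj u t ∧ AuxT G S u t := by
  induction p with
  | nil => exact id
  | @cons a b c h p ih =>
    rintro ⟨u, hu, hT⟩
    exact ih ⟨a, h, aux_step h2 hu h hT⟩

theorem aux_inter {V : Type*} [Fintype V] [DecidableEq V] (G : SimpleGraph V)
    (h2 : IsKConnected G 2) {x y : V} (X : G.Walk x x) (Y : G.Walk y y)
    (hX : IsLongestCycle G X) (hY : IsLongestCycle G Y) :
    ∃ v ∈ X.support, v ∈ Y.support := by
  by_contra! hdis
  have hxs := X.adj_snd hX.1.not_nil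
  have hys := Y.adj_snd hY.1.not_nil
  have hlen : X.length = Y.length := le_antisymm (hY.2 _ _ hX.1) (hX.2 _ _ hY.1)
  have hl3 := hX.1.three_le_length
  have hxy : x ≠ y := fun h => hdis x X.start_mem_support (h ▸ Y.start_mem_support)
  have hwalk : ∃ p : G.Walk x y, True := by
    have : ∃ c : V, c ∉ ({x, y} : Finset V) := by
      by_contra! hh
      have h3 := Finset.card_le_card (show Finset.univ ⊆ ({x, y} : Finset V) from fun c _ => hh c)
      have h4 := Finset.card_le_two (a := x) (b := y)
      have h5 := h2.1
      rw [Finset.card_univ] at h3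
      omega
    obtain ⟨c, hc⟩ := this
    simp only [Finset.mem_insert, Finset.mem_singleton, not_or] at hc
    obtain ⟨p, -⟩ := aux_avoid h2 (Ne.symm hc.1) (Ne.symm hc.2)
    exact ⟨p, trivial⟩
  obtain ⟨w, -⟩ := hwalk
  obtain ⟨u, hu, hT⟩ := aux_walk h2 (S := {v | v ∈ X.support}) w ⟨X.snd, hxs.symm,
    X.snd, x, Walk.nil, Walk.nil, X.getVert_mem_support 1, X.start_mem_support, by
      simpa using hxs.ne'⟩
  obtain ⟨a, b, p, q, ha, hb, hd⟩ := aux_step h2 hu hys hT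
  obtain ⟨y1, x1, P, ⟨hP, hy1, hx1, hPY, hPX⟩, hPs⟩ :=
    aux_abpath {v | v ∈ Y.support} {v | v ∈ X.support} p Y.start_mem_support ha
  obtain ⟨y2, x2, Q, ⟨hQ, hy2, hx2, hQY, hQX⟩, hQs⟩ :=
    aux_abpath {v | v ∈ Y.support} {v | v ∈ X.support} q (Y.getVert_mem_support 1) hb
  have hPQ : ∀ t ∈ P.support, t ∉ Q.support := fun t h h' => hd t (hPs t h) (hQs t h')
  simp only [Set.mem_ofPred_eq] at hy1 hx1 hy2 hx2 hPY hPX hQY hQX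
  have hx12 : x1 ≠ x2 := by
    rintro rfl
    exact hPQ _ P.end_mem_support Q.end_mem_support
  have hy12 : y1 ≠ y2 := by
    rintro rfl
    exact hPQ _ P.start_mem_support Q.start_mem_support
  obtain ⟨α, hα, hαX, hαl⟩ := aux_arc X hX.1 hx1 hx2 hx12
  obtain ⟨β, hβ, hβY, hβl⟩ := aux_arc Y hY.1 hy2 hy1 hy12.symm
  have hPl : P.length ≠ 0 := by
    intro h
    have := Walk.eq_of_length_eq_zero h
    subst this
    exact hdis _ hx1 hy1
  have hQl : Q.length ≠ 0 := by
    intro h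
    have := Walk.eq_of_length_eq_zero h
    subst this
    exact hdis _ hx2 hy2
  have h1 : (β.append P).IsPath := aux_append hβ hP fun v hv hv' => hPY v hv' (hβY v hv)
  have h3 : (Q.reverse.append (β.append P)).IsPath := by
    refine aux_append hQ.reverse h1 fun v hv hv' => ?_
    rw [Walk.support_reverse, List.mem_reverse] at hv
    rw [Walk.mem_support_append_iff] at hv'
    rcases hv' with hv' | hv'
    · exact hQY v hv (hβY v hv')
    · exact absurd hv (hPQ v hv')
  have h4 : (α.append (Q.reverse.append (β.append P))).IsCycle := by
    refine hα.isCycle_append h3 ?_ (Or.inr ?_)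
    · intro v hv hv'
      have hvX := hαX v (List.mem_of_mem_tail hv)
      have hne1 : v ≠ x1 := by
        rintro rfl
        have h := hα.support_nodup
        rw [← Walk.cons_tail_support, List.nodup_cons] at h
        exact h.1 hv
      have hne2 : v ≠ x2 := by
        rintro rfl
        have h := h3.support_nodup
        rw [← Walk.cons_tail_support, List.nodup_cons] at h
        exact h.1 hv'
      have hv' := List.mem_of_mem_tail hv'
      rw [Walk.mem_support_append_iff, Walk.mem_support_append_iff, Walk.support_reverse,
        List.mem_reverse] at hv'
      rcases hv' with hv' | hv' | hv'
      · exact hne2 (hQX v hv' hvX)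
      · exact hdis v hvX (hβY v hv')
      · exact hne1 (hPX v hv' hvX)
    · simp only [Walk.length_append, Walk.length_reverse]
      omega
  have h5 := hX.2 _ _ h4
  simp only [Walk.length_append, Walk.length_reverse] at h5
  omega

theorem stmt_6 {V : Type*} [Fintype V] [DecidableEq V] (G : SimpleGraph V)
    (h2 : IsKConnected G 2) {x y : V} (X : G.Walk x x) (Y : G.Walk y y)
    (hX : IsLongestCycle G X) (hY : IsLongestCycle G Y)
    (A : Set V)
    (hA : Separates G {v | v ∈ X.support} {v | v ∈ Y.support} A) :
    ∀ {z : V} (Z : G.Walk z z), IsLongestCycle G Z → ∃ v ∈ Z.support, v ∈ A := by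
  intro z Z hZ
  obtain ⟨a, haX, haZ⟩ := aux_inter G h2 X Z hX hZ
  obtain ⟨b, hbY, hbZ⟩ := aux_inter G h2 Y Z hY hZ
  obtain ⟨p, hp⟩ : ∃ p : G.Walk a b, ∀ v ∈ p.support, v ∈ Z.support := by
    by_cases hab : a = b
    · subst hab
      exact ⟨Walk.nil, by simpa using haZ⟩
    · obtain ⟨p, -, hp, -⟩ := aux_arc Z hZ.1 haZ hbZ hab
      exact ⟨p, hp⟩
  obtain ⟨a', b', q, hq, hqs⟩ :=
    aux_abpath {v | v ∈ X.support} {v | v ∈ Y.support} p haX hbY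
  obtain ⟨v, hv, hvA⟩ := hA q hq
  exact ⟨v, hp v (hqs v hv), hvA⟩
end

section
/- Let m ≥ 2 be an integer and let (i_1, j_1), …, (i_r, j_r) be r distinct pairs of integers with 1 ≤ i_t < j_t ≤ m for all t ∈ {1,…,r}, such that any two of the pairs are non-crossing. Then r ≤ 2m − 3. -/
/-- Two index pairs `(p.1, p.2)` and `(q.1, q.2)` (with `p.1 < p.2`, `q.1 < q.2`) are
crossing: all four indices are pairwise distinct and the interval `[p.1, p.2]` contains
exactly one element of `{q.1, q.2}`. -/
def Crossing (p q : ℕ × ℕ) : Prop :=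
  p.1 ≠ q.1 ∧ p.1 ≠ q.2 ∧ p.2 ≠ q.1 ∧ p.2 ≠ q.2 ∧
    Xor' (p.1 ≤ q.1 ∧ q.1 ≤ p.2) (p.1 ≤ q.2 ∧ q.2 ≤ p.2)

theorem aux_interval (n : ℕ) : ∀ (a b : ℕ), b = a + n + 1 → ∀ (T : Finset (ℕ × ℕ)),
    (∀ p ∈ T, a ≤ p.1 ∧ p.1 < p.2 ∧ p.2 ≤ b) →
    (∀ p ∈ T, ∀ q ∈ T, ¬ Crossing p q) → T.card ≤ 2 * n + 1 := by
  induction n using Nat.strong_induction_on with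
  | _ n ih =>
  intro a b hb T hT hc
  rcases Nat.eq_zero_or_pos n with h0 | hn
  · subst h0
    have hsub : T ⊆ {(a, b)} := by
      intro p hp
      have := hT p hp
      rw [Finset.mem_singleton]
      ext <;> simp <;> omega
    simpa using Finset.card_le_card hsub
  · let C := (Finset.Ioo a b).filter (fun c => c = a + 1 ∨ (a, c) ∈ T)
    have hne : C.Nonempty := ⟨a + 1, by simp [C]; omega⟩
    obtain ⟨c, hmem, hmax⟩ : ∃ c, c ∈ C ∧ ∀ x ∈ C, x ≤ c :=
      ⟨C.max' hne, C.max'_mem hne, fun x hx => C.le_max' x hx⟩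
    simp only [C, Finset.mem_filter, Finset.mem_Ioo] at hmem hmax
    obtain ⟨⟨hac, hcb⟩, hc'⟩ := hmem
    have h1 := ih (c - a - 1) (by omega) a c (by omega)
      (T.filter (fun p => p.2 ≤ c)) (by
        intro p hp
        rw [Finset.mem_filter] at hp
        have := hT p hp.1
        omega) (by
        intro p hp q hq
        exact hc p (Finset.mem_filter.1 hp).1 q (Finset.mem_filter.1 hq).1)
    have h2 := ih (b - c - 1) (by omega) c b (by omega)
      (T.filter (fun p => c ≤ p.1)) (by
        intro p hp
        rw [Finset.mem_filter] at hp
        have := hT p hp.1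
        omega) (by
        intro p hp q hq
        exact hc p (Finset.mem_filter.1 hp).1 q (Finset.mem_filter.1 hq).1)
    have hsub : T ⊆ {(a, b)} ∪ (T.filter (fun p => p.2 ≤ c) ∪ T.filter (fun p => c ≤ p.1)) := by
      rintro ⟨i, j⟩ hp
      have hb1 := hT _ hp
      simp only [Finset.mem_union, Finset.mem_singleton, Finset.mem_filter, hp, true_and,
        Prod.mk.injEq]
      simp only at hb1
      by_contra hcon
      push Not at hcon
      obtain ⟨g1, g2, g3⟩ := hcon
      by_cases hia : i = a
      · subst hia
        have := g1 rfl
        have := hmax j ⟨⟨by omega, by omega⟩, Or.inr hp⟩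
        omega
      · rcases hc' with h | h
        · omega
        · apply hc _ h _ hp
          refine ⟨?_, ?_, ?_, ?_, Or.inl ⟨?_, ?_⟩⟩ <;> simp only <;> omega
    have k1 := Finset.card_le_card hsub
    have k2 := Finset.card_union_le {(a, b)}
      (T.filter (fun p => p.2 ≤ c) ∪ T.filter (fun p => c ≤ p.1))
    have k3 := Finset.card_union_le (T.filter (fun p => p.2 ≤ c)) (T.filter (fun p => c ≤ p.1))
    rw [Finset.card_singleton] at k2
    omega

theorem stmt_9 (m : ℕ) (hm : 2 ≤ m) (S : Finset (ℕ × ℕ))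
    (hS : ∀ p ∈ S, 1 ≤ p.1 ∧ p.1 < p.2 ∧ p.2 ≤ m)
    (hcross : ∀ p ∈ S, ∀ q ∈ S, ¬ Crossing p q) :
    S.card ≤ 2 * m - 3 := by
  have := aux_interval (m - 2) 1 m (by omega) S hS hcross
  omega
end

section
/- Let m ≥ 1 be an integer and let F be a bipartite graph with parts {x_1, …, x_m} and {y_1, …, y_m}, and suppose F has E edges with E ≥ m. Then the number of pairs (i, j) with 1 ≤ i < j ≤ m such that x_i and x_j have at least 7 common neighbors in F is at least E(E − m)/(2m²) − 3(m − 1). -/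
open SimpleGraph

theorem stmt_10 (m : ℕ) (hm : 1 ≤ m)
    (F : SimpleGraph (Fin m ⊕ Fin m)) [DecidableRel F.Adj]
    -- `F` is bipartite with parts `{x_1, …, x_m}` (the left summands) and
    -- `{y_1, …, y_m}` (the right summands)
    (hbip : ∀ a b, F.Adj a b → (a.isLeft = true ∧ b.isRight = true) ∨
      (a.isRight = true ∧ b.isLeft = true))
    (E : ℕ) (hE : F.edgeFinset.card = E) (hEm : m ≤ E) :
    ((E : ℝ) * ((E : ℝ) - (m : ℝ))) / (2 * (m : ℝ) ^ 2) - 3 * ((m : ℝ) - 1) ≤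
      ((Finset.univ.filter (fun p : Fin m × Fin m =>
        p.1 < p.2 ∧
          7 ≤ (F.neighborFinset (Sum.inl p.1) ∩ F.neighborFinset (Sum.inl p.2)).card)).card : ℝ) := by
  classical
  have hm0 : (0 : ℝ) < m := by exact_mod_cast hm
  set a : Fin m → Fin m → ℝ := fun i y => if F.Adj (Sum.inl i) (Sum.inr y) then 1 else 0 with ha
  -- number of edges
  have hEsum : (E : ℝ) = ∑ y, ∑ i, a i y := by
    have h1 : F.edgeFinset = (Finset.univ.filter (fun p : Fin m × Fin m =>
        F.Adj (Sum.inl p.1) (Sum.inr p.2))).image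
          (fun p => s(Sum.inl p.1, Sum.inr p.2)) := by
      ext e
      induction e using Sym2.ind with
      | _ u v =>
        simp only [SimpleGraph.mem_edgeFinset, SimpleGraph.mem_edgeSet, Finset.mem_image,
          Finset.mem_filter, Finset.mem_univ, true_and, Prod.exists]
        constructor
        · intro h
          rcases u with u | u <;> rcases v with v | v
          · have := hbip _ _ h
            simp at this
          · exact ⟨u, v, h, rfl⟩
          · exact ⟨v, u, h.symm, Sym2.eq_swap⟩
          · have := hbip _ _ h
            simp at this
        · rintro ⟨i, y, h, he⟩
          rw [← SimpleGraph.mem_edgeSet, ← he]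
          exact h
    have h2 : F.edgeFinset.card = (Finset.univ.filter (fun p : Fin m × Fin m =>
        F.Adj (Sum.inl p.1) (Sum.inr p.2))).card := by
      rw [h1]
      apply Finset.card_image_of_injective
      rintro ⟨i, y⟩ ⟨j, z⟩ h
      simpa using h
    rw [← hE, h2, Finset.sum_comm, ← Fintype.sum_prod_type' (f := fun i y => a i y)]
    simp [ha]
  have hc : ∀ i j, ((F.neighborFinset (Sum.inl i) ∩ F.neighborFinset (Sum.inl j)).card : ℝ)
      = ∑ y, a i y * a j y := by
    intro i j
    have h1 : F.neighborFinset (Sum.inl i) ∩ F.neighborFinset (Sum.inl j)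
      = (Finset.univ.filter (fun y : Fin m =>
        F.Adj (Sum.inl i) (Sum.inr y) ∧ F.Adj (Sum.inl j) (Sum.inr y))).image Sum.inr := by
      ext v
      rcases v with v | v
      · have : ¬ F.Adj (Sum.inl i) (Sum.inl v) := fun h => by
          have := hbip _ _ h
          simp at this
        simp [this]
      · simp
    rw [h1, Finset.card_image_of_injective _ Sum.inr_injective]
    simp only [ha, ← ite_and, mul_ite, mul_one, mul_zero]
    rw [Finset.card_filter]
    push_cast
    refine Finset.sum_congr rfl fun y _ => ?_
    congr 1
    exact propext and_comm
  set c : Fin m → Fin m → ℝ := fun i j => ∑ y, a i y * a j y with hcdef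
  have hcsymm : ∀ i j, c i j = c j i := fun i j =>
    Finset.sum_congr rfl fun y _ => mul_comm _ _
  have hall : ∑ i, ∑ j, c i j = ∑ y, (∑ i, a i y) ^ 2 := by
    simp only [hcdef, sq, Finset.sum_mul_sum]
    rw [Finset.sum_comm' (t' := Finset.univ) (s' := fun _ => Finset.univ) (by simp)]
    rw [Finset.sum_comm]
    conv_lhs => enter [2, i]; rw [Finset.sum_comm]
    rw [Finset.sum_comm]
  have hdiag : ∑ i, c i i = E := by
    rw [hEsum, Finset.sum_comm]
    refine Finset.sum_congr rfl fun i _ => Finset.sum_congr rfl fun y _ => ?_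
    simp [ha]
  have hCS : (E : ℝ) ^ 2 ≤ m * ∑ i, ∑ j, c i j := by
    rw [hall, hEsum]
    simpa using sq_sum_le_card_mul_sum_sq (s := (Finset.univ : Finset (Fin m)))
      (f := fun y => ∑ i, a i y)
  have hcm : ∀ i j, c i j ≤ m := by
    intro i j
    calc c i j ≤ ∑ y : Fin m, (1 : ℝ) := by
          refine Finset.sum_le_sum fun y _ => ?_
          simp only [ha]
          split_ifs <;> norm_num
      _ = m := by simp
  -- bound off-diagonal
  set g : Fin m → Fin m → ℝ := fun i j =>
    if i < j ∧ 7 ≤ (F.neighborFinset (Sum.inl i) ∩ F.neighborFinset (Sum.inl j)).card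
      then 1 else 0 with hg
  have hP : ((Finset.univ.filter (fun p : Fin m × Fin m =>
        p.1 < p.2 ∧
          7 ≤ (F.neighborFinset (Sum.inl p.1) ∩ F.neighborFinset (Sum.inl p.2)).card)).card : ℝ)
      = ∑ i, ∑ j, g i j := by
    rw [← Fintype.sum_prod_type' (f := fun i j => g i j), Finset.card_filter]
    push_cast
    rfl
  have hpt : ∀ i j, c i j ≤ m * g i j + m * g j i + 6 + (if i = j then c i i - 6 else 0) := by
    intro i j
    have g0 : ∀ i j, 0 ≤ (m : ℝ) * g i j := by
      intro i j
      simp only [hg]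
      split_ifs <;> simp
    by_cases hij : i = j
    · subst hij
      have := g0 i i
      simp only [if_true]
      linarith
    · simp only [hij, if_false, add_zero]
      by_cases h7 : 7 ≤ (F.neighborFinset (Sum.inl i) ∩ F.neighborFinset (Sum.inl j)).card
      · have h7' := h7
        rw [Finset.inter_comm] at h7'
        have := hcm i j
        rcases lt_or_gt_of_ne hij with h | h
        · have h1 : g i j = 1 := if_pos ⟨h, h7⟩
          have := g0 j i
          rw [h1]; linarith
        · have h1 : g j i = 1 := if_pos ⟨h, h7'⟩
          have := g0 i j
          rw [h1]; linarith
      · have h6 : c i j ≤ 6 := by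
          refine (hc i j).symm.le.trans ?_
          exact_mod_cast (by omega : (F.neighborFinset (Sum.inl i) ∩ F.neighborFinset (Sum.inl j)).card ≤ 6)
        have := g0 j i
        have := g0 i j
        linarith
  have hsum : ∑ i, ∑ j, c i j ≤ 2 * m * (∑ i, ∑ j, g i j) + 6 * m ^ 2 + (E - 6 * m) := by
    calc ∑ i, ∑ j, c i j ≤ ∑ i, ∑ j, (m * g i j + m * g j i + 6 + (if i = j then c i i - 6 else 0)) :=
          Finset.sum_le_sum fun i _ => Finset.sum_le_sum fun j _ => hpt i j
      _ = _ := by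
        simp only [Finset.sum_add_distrib, ← Finset.mul_sum, Finset.sum_ite_eq, Finset.mem_univ,
          if_true, Finset.sum_sub_distrib, hdiag]
        rw [Finset.sum_comm (f := fun i j => g j i)]
        simp
        ring
  rw [hP]
  set P := ∑ i, ∑ j, g i j
  rw [sub_le_iff_le_add, div_le_iff₀ (by positivity)]
  have := mul_le_mul_of_nonneg_left hsum hm0.le
  nlinarith
end

section
/- Let m ≥ 2 be an integer and let F be a bipartite graph with parts {x_1, …, x_m} and {y_1, …, y_m}. Suppose that the set L = {(i, j) : 1 ≤ i < j ≤ m and |N_F(x_i) ∩ N_F(x_j)| ≥ 7} satisfies |L| ≤ 2m − 3. Then the number of edges of F satisfies e(F) ≤ √10·m^(3/2) + m/2. -/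
open SimpleGraph

theorem stmt_11 (m : ℕ) (hm : 2 ≤ m)
    (F : SimpleGraph (Fin m ⊕ Fin m)) [DecidableRel F.Adj]
    -- `F` is bipartite with parts `{x_1, …, x_m}` (the left summands) and
    -- `{y_1, …, y_m}` (the right summands)
    (hbip : ∀ a b, F.Adj a b → (a.isLeft = true ∧ b.isRight = true) ∨
      (a.isRight = true ∧ b.isLeft = true))
    -- the set `L` of pairs `i < j` with at least 7 common neighbors has size at most `2m − 3`
    (hL : (Finset.univ.filter (fun p : Fin m × Fin m =>
        p.1 < p.2 ∧
          7 ≤ (F.neighborFinset (Sum.inl p.1) ∩ F.neighborFinset (Sum.inl p.2)).card)).card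
        ≤ 2 * m - 3) :
    (F.edgeFinset.card : ℝ) ≤ Real.sqrt 10 * (m : ℝ) ^ ((3 : ℝ) / 2) + (m : ℝ) / 2 := by
  classical
  have hll : ∀ i j, ¬ F.Adj (Sum.inl i) (Sum.inl j) := fun i j h => by
    have := hbip _ _ h
    simp at this
  have hrr : ∀ i j, ¬ F.Adj (Sum.inr i) (Sum.inr j) := fun i j h => by
    have := hbip _ _ h
    simp at this
  let a : Fin m → Fin m → ℝ := fun i y => if F.Adj (Sum.inl i) (Sum.inr y) then 1 else 0
  let l : Fin m × Fin m → Prop := fun p => p.1 < p.2 ∧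
          7 ≤ (F.neighborFinset (Sum.inl p.1) ∩ F.neighborFinset (Sum.inl p.2)).card
  let t : Fin m → Fin m → ℝ := fun i j => if l (i, j) then 1 else 0
  have ht0 : ∀ i j, 0 ≤ t i j := fun i j => by
    simp only [t]; split_ifs <;> norm_num
  have ha2 : ∀ i y, a i y * a i y = a i y := fun i y => by
    simp only [a]; split_ifs <;> norm_num
  have ha0 : ∀ i y, 0 ≤ a i y := fun i y => by
    simp only [a]; split_ifs <;> norm_num
  have ha1 : ∀ i y, a i y ≤ 1 := fun i y => by
    simp only [a]; split_ifs <;> norm_num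
  have hmm : (2 : ℝ) ≤ m := by exact_mod_cast hm
  -- edges
  have hdeg : ∀ v, (F.degree v : ℝ) = ∑ w, if F.Adj v w then (1 : ℝ) else 0 := fun v => by
    rw [← SimpleGraph.card_neighborFinset_eq_degree, SimpleGraph.neighborFinset_eq_filter]
    simp
  have hE : (F.edgeFinset.card : ℝ) = ∑ y, ∑ i, a i y := by
    have h := F.sum_degrees_eq_twice_card_edges
    have h' : (∑ v, (F.degree v : ℝ)) = 2 * (F.edgeFinset.card : ℝ) := by exact_mod_cast h
    simp only [hdeg, Fintype.sum_sum_type, hll, hrr, if_false, Finset.sum_const_zero,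
      zero_add, add_zero] at h'
    have e2 : (∑ y, ∑ i, if F.Adj (Sum.inr y) (Sum.inl i) then (1 : ℝ) else 0)
        = ∑ y, ∑ i, a i y := by
      simp only [a, F.adj_comm (Sum.inr _) (Sum.inl _)]
    have e1 : (∑ i, ∑ y, if F.Adj (Sum.inl i) (Sum.inr y) then (1 : ℝ) else 0)
        = ∑ y, ∑ i, a i y := Finset.sum_comm
    rw [e1, e2] at h'
    linarith
  have hcod : ∀ i j, ((F.neighborFinset (Sum.inl i) ∩ F.neighborFinset (Sum.inl j)).card : ℝ)
      = ∑ y, a i y * a j y := fun i j => by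
    have : F.neighborFinset (Sum.inl i) ∩ F.neighborFinset (Sum.inl j)
        = Finset.univ.filter (fun w => F.Adj (Sum.inl i) w ∧ F.Adj (Sum.inl j) w) := by
      ext w; simp
    rw [this, Finset.card_filter]
    push_cast
    rw [Fintype.sum_sum_type]
    simp only [hll, false_and, if_false, Finset.sum_const_zero, zero_add]
    refine Finset.sum_congr rfl fun y _ => ?_
    simp only [a]
    split_ifs <;> simp_all
  have hcm : ∀ i j, ∑ y, a i y * a j y ≤ m := fun i j => by
    calc ∑ y, a i y * a j y ≤ ∑ y : Fin m, (1 : ℝ) :=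
          Finset.sum_le_sum fun y _ => mul_le_one₀ (ha1 _ _) (ha0 _ _) (ha1 _ _)
      _ = m := by simp
  have hlt : ∀ i j, i < j → ∑ y, a i y * a j y ≤ 6 + m * t i j := fun i j hij => by
    by_cases hl : l (i, j)
    · have : t i j = 1 := if_pos hl
      rw [this]; linarith [hcm i j]
    · have h0 : t i j = 0 := if_neg hl
      rw [h0, ← hcod]
      have : (F.neighborFinset (Sum.inl i) ∩ F.neighborFinset (Sum.inl j)).card ≤ 6 := by
        by_contra hc
        exact hl ⟨hij, by simp only; omega⟩
      have : ((F.neighborFinset (Sum.inl i) ∩ F.neighborFinset (Sum.inl j)).card : ℝ) ≤ 6 := by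
        exact_mod_cast this
      linarith
  have hc : ∀ i j, ∑ y, a i y * a j y ≤
      6 + m * t i j + m * t j i + if i = j then ∑ y, a i y else 0 := fun i j => by
    have p1 : 0 ≤ m * t i j := mul_nonneg (by linarith) (ht0 _ _)
    have p2 : 0 ≤ m * t j i := mul_nonneg (by linarith) (ht0 _ _)
    rcases lt_trichotomy i j with h | h | h
    · rw [if_neg h.ne]; linarith [hlt i j h]
    · subst h
      simp only [ha2, if_true]; linarith
    · rw [if_neg h.ne']
      have := hlt j i h
      simp only [mul_comm (a j _)] at this
      linarith
  have hT : ∑ i, ∑ j, t i j ≤ 2 * m - 3 := by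
    have h1 : ∑ i, ∑ j, t i j = ((Finset.univ.filter l).card : ℝ) := by
      rw [Finset.card_filter]
      push_cast
      rw [Fintype.sum_prod_type]
    have h2 : (Finset.univ.filter l).card ≤ 2 * m - 3 := by
      convert hL
    have h3 : (Finset.univ.filter l).card + 3 ≤ 2 * m := by omega
    have h4 : ((Finset.univ.filter l).card : ℝ) + 3 ≤ 2 * m := by exact_mod_cast h3
    linarith
  have hT' : ∑ i, ∑ j, t j i ≤ 2 * m - 3 := by rw [Finset.sum_comm]; exact hT
  set E : ℝ := (F.edgeFinset.card : ℝ) with hEdef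
  have hS : ∑ y, (∑ i, a i y) ^ 2 ≤ 6 * m ^ 2 + 2 * (m * (2 * m - 3)) + E := by
    have e1 : ∑ y, (∑ i, a i y) ^ 2 = ∑ i, ∑ j, ∑ y, a i y * a j y := by
      simp only [sq, Finset.sum_mul_sum]
      rw [Finset.sum_comm]
      refine Finset.sum_congr rfl fun i _ => Finset.sum_comm
    rw [e1]
    have e2 := Finset.sum_le_sum fun i (_ : i ∈ Finset.univ) =>
      Finset.sum_le_sum fun j (_ : j ∈ Finset.univ) => hc i j
    refine e2.trans ?_
    simp only [Finset.sum_add_distrib, ← Finset.mul_sum, Finset.sum_ite_eq, Finset.mem_univ,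
      if_true, Finset.sum_const, Finset.card_univ, Fintype.card_fin, nsmul_eq_mul]
    rw [hE, Finset.sum_comm (f := fun i y => a i y)]
    have q1 := mul_le_mul_of_nonneg_left hT (by linarith : (0 : ℝ) ≤ m)
    have q2 := mul_le_mul_of_nonneg_left hT' (by linarith : (0 : ℝ) ≤ m)
    nlinarith
  have hCS : E ^ 2 ≤ m * ∑ y, (∑ i, a i y) ^ 2 := by
    rw [hE]
    simpa using sq_sum_le_card_mul_sum_sq (s := Finset.univ) (f := fun y => ∑ i, a i y)
  have hfin : (E - m / 2) ^ 2 ≤ 10 * (m : ℝ) ^ 3 := by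
    have := mul_le_mul_of_nonneg_left hS (by linarith : (0 : ℝ) ≤ m)
    nlinarith [sq_nonneg (m : ℝ)]
  have h5 := Real.le_sqrt_of_sq_le hfin
  have h6 : Real.sqrt (10 * (m : ℝ) ^ 3) = Real.sqrt 10 * (m : ℝ) ^ ((3 : ℝ) / 2) := by
    rw [Real.sqrt_mul (by norm_num), Real.sqrt_eq_rpow ((m : ℝ) ^ 3), ← Real.rpow_natCast,
      ← Real.rpow_mul (by linarith)]
    norm_num
  linarith
end

section
/- Let G be a finite simple graph, let X and Y be longest cycles of G, set M = V(X) ∩ V(Y) and m = |M| ≥ 1. Then every collection of pairwise vertex-disjoint (V(X)∖M, V(Y)∖M)-paths in G has size at most √10·m^(3/2) + m/2. -/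
open SimpleGraph

namespace LC
section lists
variable {V : Type*} (G : SimpleGraph V)

def Pth (l : List V) (u v : V) : Prop :=
  l.IsChain G.Adj ∧ l.head? = some u ∧ l.getLast? = some v

def Conn (c : List V) (u v : V) : Prop := (u :: (c ++ [v])).IsChain G.Adj

variable {G}

lemma Conn.reverse {c : List V} {u v : V} (h : Conn G c u v) : Conn G c.reverse v u := by
  unfold Conn at *
  have : (v :: (c.reverse ++ [u])) = (u :: (c ++ [v])).reverse := by simp
  rw [this, List.isChain_reverse]
  exact h.imp fun a b hab => hab.symm

lemma Pth.reverse {c : List V} {u v : V} (h : Pth G c u v) : Pth G c.reverse v u := by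
  obtain ⟨h1, h2, h3⟩ := h
  refine ⟨?_, by simpa using h3, by simpa using h2⟩
  rw [List.isChain_reverse]
  exact h1.imp fun a b hab => hab.symm

lemma Pth.app {l c l' : List V} {u v w z : V} (h : Pth G l u v) (hc : Conn G c v w)
    (h' : Pth G l' w z) : Pth G (l ++ (c ++ l')) u z := by
  obtain ⟨h1, h2, h3⟩ := h
  obtain ⟨h1', h2', h3'⟩ := h'
  unfold Conn at hc
  refine ⟨?_, by simp [h2], by simp [h3']⟩
  rw [← List.singleton_append, List.isChain_append, List.isChain_append] at hc
  rw [List.isChain_append, List.isChain_append]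
  rcases hcc : c with _ | ⟨c0, c1⟩
  · subst hcc
    simp [h2', h3, h1, h1'] at hc ⊢
    exact hc
  · subst hcc
    simp only [h2', h3, h1, h1']
    simp at hc ⊢
    tauto

/-- connector: interior, path, interior -/
lemma Conn.mk3 {l c c' : List V} {a u v b : V} (h : Conn G c a u) (hl : Pth G l u v)
    (h' : Conn G c' v b) : Conn G (c ++ (l ++ c')) a b := by
  have h1 : Pth G [a] a a := ⟨by simp, by simp, by simp⟩
  have h2 : Pth G [b] b b := ⟨by simp, by simp, by simp⟩
  have h3 := (h1.app h hl).app h' h2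
  have := h3.1
  unfold Conn
  simpa using this

lemma cyc_len {n : ℕ} (hmax : ∀ (y : V) (W : G.Walk y y), W.IsCycle → W.length ≤ n)
    {l : List V} {u v : V} (h : Pth G l u v) (huv : G.Adj v u) (hnd : l.Nodup) (h3 : 3 ≤ l.length) :
    l.length ≤ n := by
  obtain ⟨h1, h2, h3'⟩ := h
  have hne : l ≠ [] := by rintro rfl; simp at h3
  have e1 : l.head hne = u := by
    rw [List.head?_eq_some_head hne] at h2; simpa using h2
  have e2 : l.getLast hne = v := by
    rw [List.getLast?_eq_some_getLast hne] at h3'; simpa using h3'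
  let W := Walk.ofSupport l hne h1
  have hs : W.support = l := Walk.support_ofSupport hne h1
  have hadj : G.Adj (l.getLast hne) (l.head hne) := by rw [e1, e2]; exact huv
  have hlen : W.length + 1 = l.length := by
    have := congrArg List.length hs
    rwa [Walk.length_support] at this
  have hp : W.IsPath := by rw [Walk.isPath_def, hs]; exact hnd
  have := hmax _ (Walk.cons hadj W) (by
    rw [Walk.cons_isCycle_iff]
    refine ⟨hp, fun hmem => ?_⟩
    have := hp.length_eq_one_of_mem_edges (by rwa [Sym2.eq_swap] at hmem)
    omega)
  simp at this
  omega

def seg (X : ℕ → V) (i j : ℕ) : List V :=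
  if i ≤ j then (List.range' i (j + 1 - i)).map X else ((List.range' j (i + 1 - j)).map X).reverse

lemma mem_seg {X : ℕ → V} {i j : ℕ} {v : V} :
    v ∈ seg X i j ↔ ∃ k, ((i ≤ k ∧ k ≤ j) ∨ (j ≤ k ∧ k ≤ i)) ∧ X k = v := by
  unfold seg
  split_ifs with h <;> simp only [List.mem_reverse, List.mem_map, List.mem_range'_1] <;>
  · constructor <;> rintro ⟨k, hk, rfl⟩ <;> exact ⟨k, by omega, rfl⟩

lemma length_seg {X : ℕ → V} {i j : ℕ} : (seg X i j).length = (i - j) + (j - i) + 1 := by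
  unfold seg
  split_ifs with h <;> simp <;> omega

lemma nodup_seg {X : ℕ → V} {n : ℕ} (hX : ∀ i j, i < n → j < n → X i = X j → i = j) {i j : ℕ}
    (hi : i < n) (hj : j < n) : (seg X i j).Nodup := by
  unfold seg
  split_ifs with h
  · refine List.Nodup.map_on ?_ (List.nodup_range' ..)
    intro x hx y hy hxy
    simp only [List.mem_range'_1] at hx hy
    exact hX x y (by omega) (by omega) hxy
  · rw [List.nodup_reverse]
    refine List.Nodup.map_on ?_ (List.nodup_range' ..)
    intro x hx y hy hxy
    simp only [List.mem_range'_1] at hx hy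
    exact hX x y (by omega) (by omega) hxy

lemma pth_up {X : ℕ → V} {n : ℕ} (hX : ∀ i, i + 1 < n → G.Adj (X i) (X (i + 1))) {i j : ℕ}
    (hj : j < n) (hij : i ≤ j) : Pth G ((List.range' i (j + 1 - i)).map X) (X i) (X j) := by
  refine ⟨?_, ?_, ?_⟩
  · rw [List.isChain_iff_getElem]
    intro k hk
    simp at hk ⊢
    exact hX (i + k) (by omega)
  · have : j + 1 - i = (j - i) + 1 := by omega
    rw [this, List.range'_succ]; simp
  · rw [List.getLast?_map, List.getLast?_range']
    simp
    refine ⟨by omega, by congr 1; omega⟩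

lemma pth_seg {X : ℕ → V} {n : ℕ} (hX : ∀ i, i + 1 < n → G.Adj (X i) (X (i + 1))) {i j : ℕ}
    (hi : i < n) (hj : j < n) : Pth G (seg X i j) (X i) (X j) := by
  unfold seg
  split_ifs with h
  · exact pth_up hX hj h
  · exact (pth_up hX hi (by omega)).reverse
end lists
end LC

namespace LC
structure Sys {V : Type*} (G : SimpleGraph V) (ι : Type*) where
  n : ℕ
  X : ℕ → V
  Y : ℕ → V
  hn : 3 ≤ n
  hmax : ∀ (y : V) (W : G.Walk y y), W.IsCycle → W.length ≤ n
  Xadj : ∀ i, i + 1 < n → G.Adj (X i) (X (i + 1))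
  Xclose : G.Adj (X (n - 1)) (X 0)
  Xinj : ∀ i j, i < n → j < n → X i = X j → i = j
  Yadj : ∀ i, i + 1 < n → G.Adj (Y i) (Y (i + 1))
  Yclose : G.Adj (Y (n - 1)) (Y 0)
  Yinj : ∀ i j, i < n → j < n → Y i = Y j → i = j
  α : ι → ℕ
  β : ι → ℕ
  ρ : ι → ℕ
  κ : ι → ℕ
  αlt : ∀ t, α t < n
  βlt : ∀ t, β t < n
  αinj : ∀ s t, α s = α t → s = t
  βinj : ∀ s t, β s = β t → s = t
  ρmono : ∀ s t, α s ≤ α t → ρ s ≤ ρ t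
  κmono : ∀ s t, β s ≤ β t → κ s ≤ κ t
  ρarc : ∀ s t, ρ s = ρ t → ∀ i, α s ≤ i → i ≤ α t → ∀ j < n, X i ≠ Y j
  κarc : ∀ s t, κ s = κ t → ∀ j, β s ≤ j → j ≤ β t → ∀ i < n, Y j ≠ X i
  I : ι → List V
  Iconn : ∀ t, Conn G (I t) (X (α t)) (Y (β t))
  Inodup : ∀ t, (I t).Nodup
  IX : ∀ t, ∀ i < n, X i ∉ I t
  IY : ∀ t, ∀ i < n, Y i ∉ I t
  Idisj : ∀ s t, s ≠ t → ∀ v ∈ I s, v ∉ I t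

namespace Sys
variable {V ι : Type*} {G : SimpleGraph V}

def swap (S : Sys G ι) : Sys G ι where
  n := S.n
  X := S.Y
  Y := S.X
  hn := S.hn
  hmax := S.hmax
  Xadj := S.Yadj
  Xclose := S.Yclose
  Xinj := S.Yinj
  Yadj := S.Xadj
  Yclose := S.Xclose
  Yinj := S.Xinj
  α := S.β
  β := S.α
  ρ := S.κ
  κ := S.ρ
  αlt := S.βlt
  βlt := S.αlt
  αinj := S.βinj
  βinj := S.αinj
  ρmono := S.κmono
  κmono := S.ρmono
  ρarc := S.κarc
  κarc := S.ρarc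
  I := fun t => (S.I t).reverse
  Iconn := fun t => (S.Iconn t).reverse
  Inodup := fun t => by simpa using S.Inodup t
  IX := fun t i hi => by simpa using S.IY t i hi
  IY := fun t i hi => by simpa using S.IX t i hi
  Idisj := fun s t h v => by simpa using S.Idisj s t h v

variable (S : Sys G ι)

def cn (s t : ι) : List V := S.I s ++ (seg S.Y (S.β s) (S.β t) ++ (S.I t).reverse)

lemma cn_conn (s t : ι) : Conn G (S.cn s t) (S.X (S.α s)) (S.X (S.α t)) :=
  (S.Iconn s).mk3 (pth_seg S.Yadj (S.βlt s) (S.βlt t)) (S.Iconn t).reverse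

lemma cn_len (s t : ι) : (S.β s - S.β t) + (S.β t - S.β s) + 1 ≤ (S.cn s t).length := by
  simp only [cn, List.length_append, length_seg]; omega

lemma mem_cn {s t : ι} {v : V} : v ∈ S.cn s t ↔ v ∈ S.I s ∨ v ∈ S.I t ∨
    ∃ k, ((S.β s ≤ k ∧ k ≤ S.β t) ∨ (S.β t ≤ k ∧ k ≤ S.β s)) ∧ S.Y k = v := by
  simp only [cn, mem_seg, List.mem_append, List.mem_reverse]
  rw [or_comm (b := v ∈ S.I t)]

lemma cn_nodup {s t : ι} (h : s ≠ t) : (S.cn s t).Nodup := by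
  unfold cn
  rw [List.nodup_append', List.nodup_append']
  have hs := S.βlt s
  have ht := S.βlt t
  refine ⟨S.Inodup s, ⟨nodup_seg S.Yinj hs ht, by simpa using S.Inodup t, ?_⟩, ?_⟩
  · intro v hv hv'
    rw [mem_seg] at hv
    obtain ⟨k, hk, rfl⟩ := hv
    exact S.IY t k (by omega) (by simpa using hv')
  · intro v hv hv'
    rw [List.mem_append, mem_seg] at hv'
    rcases hv' with ⟨k, hk, rfl⟩ | hv'
    · exact S.IY s k (by omega) hv
    · exact S.Idisj s t h v hv (by simpa using hv')

lemma cn_X {s t : ι} (h : S.κ s = S.κ t) (i : ℕ) (hi : i < S.n) : S.X i ∉ S.cn s t := by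
  rw [mem_cn]
  rintro (h1 | h1 | ⟨k, hk | hk, h1⟩)
  · exact S.IX _ _ hi h1
  · exact S.IX _ _ hi h1
  · exact S.κarc s t h k hk.1 hk.2 i hi h1
  · exact S.κarc t s h.symm k hk.1 hk.2 i hi h1

lemma κlt {s t : ι} (h : S.κ s < S.κ t) : S.β s < S.β t := by
  by_contra hc
  have := S.κmono t s (by omega)
  omega

lemma ρlt {s t : ι} (h : S.ρ s < S.ρ t) : S.α s < S.α t := S.swap.κlt h

lemma cn_disj {s t s' t' : ι} (h : S.κ s = S.κ t) (h' : S.κ s' = S.κ t') (hne : S.κ s ≠ S.κ s') :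
    (S.cn s t).Disjoint (S.cn s' t') := by
  have e1 : s ≠ s' := by rintro rfl; exact hne rfl
  have e2 : s ≠ t' := by rintro rfl; exact hne h'.symm
  have e3 : t ≠ s' := by rintro rfl; exact hne h
  have e4 : t ≠ t' := by rintro rfl; exact hne (h.trans h'.symm)
  have b1 := S.βlt s
  have b2 := S.βlt t
  have b3 := S.βlt s'
  have b4 := S.βlt t'
  intro v hv hv'
  rw [mem_cn] at hv hv'
  rcases hv with hv | hv | ⟨k, hk, rfl⟩
  · rcases hv' with hv' | hv' | ⟨k', hk', rfl⟩
    · exact S.Idisj _ _ e1 _ hv hv'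
    · exact S.Idisj _ _ e2 _ hv hv'
    · exact S.IY _ _ (by omega) hv
  · rcases hv' with hv' | hv' | ⟨k', hk', rfl⟩
    · exact S.Idisj _ _ e3 _ hv hv'
    · exact S.Idisj _ _ e4 _ hv hv'
    · exact S.IY _ _ (by omega) hv
  · rcases hv' with hv' | hv' | ⟨k', hk', hkk⟩
    · exact S.IY _ _ (by omega) hv'
    · exact S.IY _ _ (by omega) hv'
    · have := S.Yinj _ _ (by omega) (by omega) hkk
      rcases Nat.lt_or_gt_of_ne hne with hlt | hlt
      · have := S.κlt hlt
        have := S.κlt (s := s) (t := t') (by omega)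
        have := S.κlt (s := t) (t := s') (by omega)
        have := S.κlt (s := t) (t := t') (by omega)
        omega
      · have := S.κlt hlt
        have := S.κlt (s := s') (t := t) (by omega)
        have := S.κlt (s := t') (t := s) (by omega)
        have := S.κlt (s := t') (t := t) (by omega)
        omega

lemma seg_cn {s t : ι} (h : S.κ s = S.κ t) {i j : ℕ} (hi : i < S.n) (hj : j < S.n) :
    (seg S.X i j).Disjoint (S.cn s t) := by
  intro v hv hv'
  rw [mem_seg] at hv
  obtain ⟨k, hk, rfl⟩ := hv
  exact S.cn_X h k (by omega) hv'

lemma seg_seg {i j i' j' : ℕ} (hi : i < S.n) (hj : j < S.n) (hi' : i' < S.n) (hj' : j' < S.n)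
    (h : (i < i' ∧ i < j' ∧ j < i' ∧ j < j') ∨ (i' < i ∧ i' < j ∧ j' < i ∧ j' < j)) :
    (seg S.X i j).Disjoint (seg S.X i' j') := by
  intro v hv hv'
  rw [mem_seg] at hv hv'
  obtain ⟨k, hk, rfl⟩ := hv
  obtain ⟨k', hk', hkk⟩ := hv'
  have := S.Xinj _ _ (by omega) (by omega) hkk
  omega

lemma E1 {a b : ι} (h : S.κ a = S.κ b) (hab : S.α a < S.α b) :
    (S.β a - S.β b) + (S.β b - S.β a) + 2 ≤ S.α b - S.α a := by
  have hn := S.hn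
  have ha := S.αlt a
  have hb := S.αlt b
  have ne : a ≠ b := by rintro rfl; omega
  have P := ((pth_seg S.Xadj (i := 0) (by omega) ha).app (S.cn_conn a b)
    (pth_seg S.Xadj (j := S.n - 1) hb (by omega)))
  have hN : (seg S.X 0 (S.α a) ++ (S.cn a b ++ seg S.X (S.α b) (S.n - 1))).Nodup := by
    simp only [List.nodup_append', List.disjoint_append_right]
    refine ⟨nodup_seg S.Xinj (by omega) (by omega), ⟨S.cn_nodup ne,
      nodup_seg S.Xinj (by omega) (by omega), (S.seg_cn h (by omega) (by omega)).symm⟩,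
      S.seg_cn h (by omega) (by omega), S.seg_seg (by omega) (by omega) (by omega) (by omega)
      (by omega)⟩
  have L := S.cn_len a b
  by_cases h3 : 3 ≤ (seg S.X 0 (S.α a) ++ (S.cn a b ++ seg S.X (S.α b) (S.n - 1))).length
  · have := cyc_len S.hmax P S.Xclose hN h3
    simp only [List.length_append, length_seg] at this
    omega
  · simp only [List.length_append, length_seg] at h3
    omega

lemma E2 {a0 a1 b1 a3 : ι} (h1 : S.κ a0 = S.κ a1) (h2 : S.κ b1 = S.κ a3)
    (hne : S.κ a0 ≠ S.κ b1)
    (o1 : S.α a0 < S.α a1) (o2 : S.α a0 < S.α b1) (o3 : S.α a1 < S.α a3) (o4 : S.α b1 < S.α a3) :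
    (S.α a0) + 1 + ((S.α a1 - S.α b1) + (S.α b1 - S.α a1) + 1) + (S.n - S.α a3)
    + ((S.β a0 - S.β a1) + (S.β a1 - S.β a0) + 1) + ((S.β b1 - S.β a3) + (S.β a3 - S.β b1) + 1)
    ≤ S.n := by
  have hn := S.hn
  have l0 := S.αlt a0
  have l1 := S.αlt a1
  have l2 := S.αlt b1
  have l3 := S.αlt a3
  have ne : a0 ≠ a1 := by rintro rfl; omega
  have ne' : b1 ≠ a3 := by rintro rfl; omega
  have P := ((pth_seg S.Xadj (i := 0) (by omega) l0).app (S.cn_conn a0 a1)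
    ((pth_seg S.Xadj l1 l2).app (S.cn_conn b1 a3) (pth_seg S.Xadj (j := S.n - 1) l3 (by omega))))
  have L := S.cn_len a0 a1
  have L' := S.cn_len b1 a3
  have := cyc_len S.hmax P S.Xclose (by
    simp only [List.nodup_append', List.disjoint_append_right]
    have D1 := @seg_cn _ _ _ S _ _ h1
    have D2 := @seg_cn _ _ _ S _ _ h2
    refine ⟨?_, ⟨?_, ⟨?_, ⟨?_, ?_, ?_⟩, ?_, ?_⟩, ?_, ?_, ?_⟩, ?_, ?_, ?_, ?_⟩
    all_goals first
      | exact S.cn_nodup ne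
      | exact S.cn_nodup ne'
      | exact S.cn_disj h1 h2 hne
      | exact nodup_seg S.Xinj (by omega) (by omega)
      | exact D1 (by omega) (by omega)
      | exact D2 (by omega) (by omega)
      | exact (D1 (by omega) (by omega)).symm
      | exact (D2 (by omega) (by omega)).symm
      | exact S.seg_seg (by omega) (by omega) (by omega) (by omega) (by omega)) (by
    simp only [List.length_append, length_seg]; omega)
  simp only [List.length_append, length_seg] at this
  omega

lemma E3 {a0 a1 b1 a2 b2 a3 : ι} (h1 : S.κ a0 = S.κ a1) (h2 : S.κ b1 = S.κ a2)
    (h3 : S.κ b2 = S.κ a3)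
    (hne : S.κ a0 ≠ S.κ b1) (hne' : S.κ a0 ≠ S.κ b2) (hne'' : S.κ b1 ≠ S.κ b2)
    (o1 : S.α a0 < S.α a1) (o2 : S.α a0 < S.α b1) (o1' : S.α a0 < S.α a2) (o2' : S.α a0 < S.α b2)
    (o3 : S.α a1 < S.α a3) (o4 : S.α b1 < S.α a3) (o3' : S.α a2 < S.α a3) (o4' : S.α b2 < S.α a3)
    (o : (S.α a1 < S.α a2 ∧ S.α a1 < S.α b2 ∧ S.α b1 < S.α a2 ∧ S.α b1 < S.α b2) ∨
      (S.α a2 < S.α a1 ∧ S.α a2 < S.α b1 ∧ S.α b2 < S.α a1 ∧ S.α b2 < S.α b1)) :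
    (S.α a0) + 1 + ((S.α a1 - S.α b1) + (S.α b1 - S.α a1) + 1)
    + ((S.α a2 - S.α b2) + (S.α b2 - S.α a2) + 1) + (S.n - S.α a3)
    + ((S.β a0 - S.β a1) + (S.β a1 - S.β a0) + 1) + ((S.β b1 - S.β a2) + (S.β a2 - S.β b1) + 1)
    + ((S.β b2 - S.β a3) + (S.β a3 - S.β b2) + 1)
    ≤ S.n := by
  have hn := S.hn
  have l0 := S.αlt a0
  have l1 := S.αlt a1
  have l2 := S.αlt b1
  have l1' := S.αlt a2
  have l2' := S.αlt b2
  have l3 := S.αlt a3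
  have ne : a0 ≠ a1 := by rintro rfl; omega
  have ne' : b1 ≠ a2 := by rintro rfl; omega
  have ne'' : b2 ≠ a3 := by rintro rfl; omega
  have P := ((pth_seg S.Xadj (i := 0) (by omega) l0).app (S.cn_conn a0 a1)
    ((pth_seg S.Xadj l1 l2).app (S.cn_conn b1 a2) ((pth_seg S.Xadj l1' l2').app (S.cn_conn b2 a3)
      (pth_seg S.Xadj (j := S.n - 1) l3 (by omega)))))
  have L := S.cn_len a0 a1
  have L' := S.cn_len b1 a2
  have L'' := S.cn_len b2 a3
  have := cyc_len S.hmax P S.Xclose (by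
    simp only [List.nodup_append', List.disjoint_append_right]
    have D1 := @seg_cn _ _ _ S _ _ h1
    have D2 := @seg_cn _ _ _ S _ _ h2
    have D3 := @seg_cn _ _ _ S _ _ h3
    refine ⟨?_, ⟨?_, ⟨?_, ⟨?_, ⟨?_, ⟨?_, ?_, ?_⟩, ?_, ?_⟩, ?_, ?_, ?_⟩, ?_, ?_, ?_, ?_⟩,
      ?_, ?_, ?_, ?_, ?_⟩, ?_, ?_, ?_, ?_, ?_, ?_⟩
    all_goals first
      | exact S.cn_nodup ne
      | exact S.cn_nodup ne'
      | exact S.cn_nodup ne''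
      | exact S.cn_disj h1 h2 hne
      | exact S.cn_disj h1 h3 hne'
      | exact S.cn_disj h2 h3 hne''
      | exact nodup_seg S.Xinj (by omega) (by omega)
      | exact D1 (by omega) (by omega)
      | exact D2 (by omega) (by omega)
      | exact D3 (by omega) (by omega)
      | exact (D1 (by omega) (by omega)).symm
      | exact (D2 (by omega) (by omega)).symm
      | exact (D3 (by omega) (by omega)).symm
      | exact S.seg_seg (by omega) (by omega) (by omega) (by omega) (by omega)) (by
    simp only [List.length_append, length_seg]; omega)
  simp only [List.length_append, length_seg] at this
  omega
end Sys
end LC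

namespace LC
def cyc (a b c : ℕ) : Prop := (a < b ∧ b < c) ∨ (b < c ∧ c < a) ∨ (c < a ∧ a < b)
def maj (a b c : Prop) : Prop := (a ∧ b) ∨ (b ∧ c) ∨ (a ∧ c)

def ds (a b : ℕ) : ℕ := (a - b) + (b - a)

namespace Sys
variable {V ι : Type*} {G : SimpleGraph V} (S : Sys G ι)

lemma rc_inj {s t : ι} (h1 : S.ρ s = S.ρ t) (h2 : S.κ s = S.κ t) : s = t := by
  by_contra hne
  have hα : S.α s ≠ S.α t := fun h => hne (S.αinj _ _ h)
  have hβ : S.β s ≠ S.β t := fun h => hne (S.βinj _ _ h)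
  have A : ds (S.β s) (S.β t) < ds (S.α s) (S.α t) := by
    unfold ds
    rcases Nat.lt_or_gt_of_ne hα with h | h
    · have := S.E1 h2 h; omega
    · have := S.E1 h2.symm h; omega
  have B : ds (S.α s) (S.α t) < ds (S.β s) (S.β t) := by
    unfold ds
    rcases Nat.lt_or_gt_of_ne hβ with h | h
    · have := S.swap.E1 h1 h
      simp only [swap] at this; omega
    · have := S.swap.E1 h1.symm h
      simp only [swap] at this; omega
  omega

lemma XE2 {t1 t2 s1 s2 : ι} (hr : S.ρ t1 = S.ρ t2) (hr' : S.ρ s1 = S.ρ s2)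
    (hc : S.κ t1 = S.κ s1) (hc' : S.κ t2 = S.κ s2) (hne : S.κ t1 ≠ S.κ t2)
    (hρ : S.ρ t1 ≠ S.ρ s1) (hg : S.α t1 < S.α t2 ↔ S.α s1 < S.α s2) :
    ds (S.β t1) (S.β s1) + ds (S.β t2) (S.β s2) < ds (S.α t1) (S.α t2) + ds (S.α s1) (S.α s2) := by
  wlog hlt : S.ρ t1 < S.ρ s1 generalizing t1 t2 s1 s2
  · have := this hr' hr hc.symm hc'.symm (by omega) hρ.symm hg.symm (by omega)
    unfold ds at *; omega
  wlog h12 : S.α t1 < S.α t2 generalizing t1 t2 s1 s2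
  · have e1 : S.α t1 ≠ S.α t2 := fun h => hne (by rw [S.αinj _ _ h])
    have e2 : S.α s1 ≠ S.α s2 := fun h => hne (by rw [hc, hc', S.αinj _ _ h])
    have := this hr.symm hr'.symm hc' hc hne.symm (by omega) (by omega) (by omega) (by omega)
    unfold ds at *; omega
  have o1 := S.ρlt hlt
  have o2 := S.ρlt (s := t2) (t := s1) (by omega)
  have o3 := S.ρlt (s := t1) (t := s2) (by omega)
  have o4 := S.ρlt (s := t2) (t := s2) (by omega)
  have l := S.αlt s2
  have := S.E2 hc hc' hne (by omega) (by omega) (by omega) (by omega)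
  unfold ds; omega

lemma C4 {t1 t2 s1 s2 : ι} (hr : S.ρ t1 = S.ρ t2) (hr' : S.ρ s1 = S.ρ s2)
    (hc : S.κ t1 = S.κ s1) (hc' : S.κ t2 = S.κ s2) (hne : S.κ t1 ≠ S.κ t2)
    (hρ : S.ρ t1 ≠ S.ρ s1) (hg : S.α t1 < S.α t2 ↔ S.α s1 < S.α s2) 
    (hg' : S.β t1 < S.β s1 ↔ S.β t2 < S.β s2) : False := by
  have h1 := S.XE2 hr hr' hc hc' hne hρ hg
  have h2 := S.swap.XE2 (t1 := t1) (t2 := s1) (s1 := t2) (s2 := s2) hc hc' hr hr' hρ hne hg'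
  simp only [swap] at h2
  omega

lemma XE3o {u12 u13 u23 u21 u31 u32 : ι} (r1 : S.ρ u12 = S.ρ u13) (r2 : S.ρ u23 = S.ρ u21)
    (r3 : S.ρ u31 = S.ρ u32) (c1 : S.κ u12 = S.κ u21) (c2 : S.κ u23 = S.κ u32)
    (c3 : S.κ u31 = S.κ u13) (n1 : S.κ u12 ≠ S.κ u23) (n2 : S.κ u23 ≠ S.κ u31)
    (n3 : S.κ u31 ≠ S.κ u12) (m1 : S.ρ u12 < S.ρ u23) (m2 : S.ρ u23 < S.ρ u31)
    (hg : maj (S.α u12 < S.α u13) (S.α u23 < S.α u21) (S.α u31 < S.α u32)) :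
    ds (S.β u12) (S.β u21) + ds (S.β u23) (S.β u32) + ds (S.β u31) (S.β u13) <
    ds (S.α u12) (S.α u13) + ds (S.α u21) (S.α u23) + ds (S.α u31) (S.α u32) := by
  have e1 : S.α u12 ≠ S.α u13 := fun h => n3 (by rw [c3, S.αinj _ _ h])
  have e2 : S.α u23 ≠ S.α u21 := fun h => n1 (by rw [c1, S.αinj _ _ h])
  have e3 : S.α u31 ≠ S.α u32 := fun h => n2 (by rw [c2, S.αinj _ _ h])
  have q1 := S.ρlt (s := u12) (t := u23) (by omega)
  have q2 := S.ρlt (s := u12) (t := u21) (by omega)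
  have q3 := S.ρlt (s := u13) (t := u23) (by omega)
  have q4 := S.ρlt (s := u13) (t := u21) (by omega)
  have q5 := S.ρlt (s := u23) (t := u31) (by omega)
  have q6 := S.ρlt (s := u23) (t := u32) (by omega)
  have q7 := S.ρlt (s := u21) (t := u31) (by omega)
  have q8 := S.ρlt (s := u21) (t := u32) (by omega)
  have l1 := S.αlt u31
  have l2 := S.αlt u32
  have key : (S.α u12 < S.α u13 ∧ S.α u23 < S.α u21 ∧ S.α u31 < S.α u32) ∨
      (S.α u13 < S.α u12 ∧ S.α u23 < S.α u21 ∧ S.α u31 < S.α u32) ∨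
      (S.α u12 < S.α u13 ∧ S.α u21 < S.α u23 ∧ S.α u31 < S.α u32) ∨
      (S.α u12 < S.α u13 ∧ S.α u23 < S.α u21 ∧ S.α u32 < S.α u31) := by
    unfold maj at hg
    omega
  unfold ds
  rcases key with ⟨k1, k2, k3⟩ | ⟨k1, k2, k3⟩ | ⟨k1, k2, k3⟩ | ⟨k1, k2, k3⟩
  · -- p1=u12 q1=u13 p2=u23 q2=u21 p3=u31 q3=u32
    have := S.E3 (a0 := u12) (a1 := u21) (b1 := u31) (a2 := u13) (b2 := u23) (a3 := u32)
      c1 c3 c2 (by omega) (by omega) (by omega) (by omega) (by omega) (by omega) (by omega)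
      (by omega) (by omega) (by omega) (by omega) (by omega)
    omega
  · -- p1=u13 q1=u12 p2=u23 q2=u21
    have := S.E3 (a0 := u13) (a1 := u31) (b1 := u21) (a2 := u12) (b2 := u23) (a3 := u32)
      c3.symm c1.symm c2 (by omega) (by omega) (by omega) (by omega) (by omega) (by omega)
      (by omega) (by omega) (by omega) (by omega) (by omega) (by omega)
    omega
  · have := S.E3 (a0 := u12) (a1 := u21) (b1 := u13) (a2 := u31) (b2 := u23) (a3 := u32)
      c1 c3.symm c2 (by omega) (by omega) (by omega) (by omega) (by omega) (by omega)
      (by omega) (by omega) (by omega) (by omega) (by omega) (by omega)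
    omega
  · have := S.E3 (a0 := u12) (a1 := u21) (b1 := u32) (a2 := u23) (b2 := u13) (a3 := u31)
      c1 c2.symm c3.symm (by omega) (by omega) (by omega) (by omega) (by omega) (by omega)
      (by omega) (by omega) (by omega) (by omega) (by omega) (by omega)
    omega

lemma XE3 {u12 u13 u23 u21 u31 u32 : ι} (r1 : S.ρ u12 = S.ρ u13) (r2 : S.ρ u23 = S.ρ u21)
    (r3 : S.ρ u31 = S.ρ u32) (c1 : S.κ u12 = S.κ u21) (c2 : S.κ u23 = S.κ u32)
    (c3 : S.κ u31 = S.κ u13) (n1 : S.κ u12 ≠ S.κ u23) (n2 : S.κ u23 ≠ S.κ u31)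
    (n3 : S.κ u31 ≠ S.κ u12) (m1 : S.ρ u12 ≠ S.ρ u23) (m2 : S.ρ u23 ≠ S.ρ u31)
    (m3 : S.ρ u31 ≠ S.ρ u12)
    (hg : cyc (S.ρ u12) (S.ρ u23) (S.ρ u31) ↔
      maj (S.α u12 < S.α u13) (S.α u23 < S.α u21) (S.α u31 < S.α u32)) :
    ds (S.β u12) (S.β u21) + ds (S.β u23) (S.β u32) + ds (S.β u31) (S.β u13) <
    ds (S.α u12) (S.α u13) + ds (S.α u21) (S.α u23) + ds (S.α u31) (S.α u32) := by
  have e1 : S.α u12 ≠ S.α u13 := fun h => n3 (by rw [c3, S.αinj _ _ h])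
  have e2 : S.α u23 ≠ S.α u21 := fun h => n1 (by rw [c1, S.αinj _ _ h])
  have e3 : S.α u31 ≠ S.α u32 := fun h => n2 (by rw [c2, S.αinj _ _ h])
  by_cases hc : cyc (S.ρ u12) (S.ρ u23) (S.ρ u31)
  · have hg := hg.1 hc
    rcases hc with ⟨x, y⟩ | ⟨x, y⟩ | ⟨x, y⟩
    · exact S.XE3o r1 r2 r3 c1 c2 c3 n1 n2 n3 x y hg
    · have := S.XE3o r2 r3 r1 c2 c3 c1 n2 n3 n1 x y (by unfold maj at *; omega)
      unfold ds at *; omega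
    · have := S.XE3o r3 r1 r2 c3 c1 c2 n3 n1 n2 x y (by unfold maj at *; omega)
      unfold ds at *; omega
  · have hg : maj (S.α u13 < S.α u12) (S.α u21 < S.α u23) (S.α u32 < S.α u31) := by
      have := mt hg.2 hc
      unfold maj at *; omega
    have hc : (S.ρ u12 < S.ρ u31 ∧ S.ρ u31 < S.ρ u23) ∨ (S.ρ u31 < S.ρ u23 ∧ S.ρ u23 < S.ρ u12) ∨
        (S.ρ u23 < S.ρ u12 ∧ S.ρ u12 < S.ρ u31) := by
      unfold cyc at hc; omega
    rcases hc with ⟨x, y⟩ | ⟨x, y⟩ | ⟨x, y⟩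
    · have := S.XE3o r1.symm r3.symm r2.symm c3.symm c2.symm c1.symm (by omega) (by omega) (by omega)
        (by omega) (by omega) (by unfold maj at *; omega)
      unfold ds at *; omega
    · have := S.XE3o r3.symm r2.symm r1.symm c2.symm c1.symm c3.symm (by omega) (by omega) (by omega)
        (by omega) (by omega) (by unfold maj at *; omega)
      unfold ds at *; omega
    · have := S.XE3o r2.symm r1.symm r3.symm c1.symm c3.symm c2.symm (by omega) (by omega) (by omega)
        (by omega) (by omega) (by unfold maj at *; omega)
      unfold ds at *; omega

lemma C6 {u12 u13 u23 u21 u31 u32 : ι} (r1 : S.ρ u12 = S.ρ u13) (r2 : S.ρ u23 = S.ρ u21)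
    (r3 : S.ρ u31 = S.ρ u32) (c1 : S.κ u12 = S.κ u21) (c2 : S.κ u23 = S.κ u32)
    (c3 : S.κ u31 = S.κ u13) (n1 : S.κ u12 ≠ S.κ u23) (n2 : S.κ u23 ≠ S.κ u31)
    (n3 : S.κ u31 ≠ S.κ u12) (m1 : S.ρ u12 ≠ S.ρ u23) (m2 : S.ρ u23 ≠ S.ρ u31)
    (m3 : S.ρ u31 ≠ S.ρ u12)
    (hg : cyc (S.ρ u12) (S.ρ u23) (S.ρ u31) ↔
      maj (S.α u12 < S.α u13) (S.α u23 < S.α u21) (S.α u31 < S.α u32))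
    (hg' : cyc (S.κ u12) (S.κ u23) (S.κ u31) ↔
      maj (S.β u21 < S.β u12) (S.β u32 < S.β u23) (S.β u13 < S.β u31)) : False := by
  have h1 := S.XE3 r1 r2 r3 c1 c2 c3 n1 n2 n3 m1 m2 m3 hg
  have h2 := S.swap.XE3 (u12 := u21) (u13 := u12) (u23 := u32) (u21 := u23) (u31 := u13)
    (u32 := u31) c1.symm c2.symm c3.symm r2.symm r3.symm r1.symm
    (by simp only [swap]; omega) (by simp only [swap]; omega) (by simp only [swap]; omega)
    (by simp only [swap]; omega) (by simp only [swap]; omega) (by simp only [swap]; omega)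
    (by simp only [swap]; rw [← c1, ← c2, ← c3]; exact hg')
  simp only [swap] at h2
  unfold ds at *
  omega
end Sys
end LC

namespace LC
structure Pat where
  R : ℕ → ℕ → Prop
  a : ℕ → ℕ → ℕ
  b : ℕ → ℕ → ℕ
  ane : ∀ r c c', R r c → R r c' → c ≠ c' → a r c ≠ a r c'
  bne : ∀ r r' c, R r c → R r' c → r ≠ r' → b r c ≠ b r' c
  c4 : ∀ r r' c c', R r c → R r c' → R r' c → R r' c' → r ≠ r' → c ≠ c' →
    (a r c < a r c' ↔ a r' c < a r' c') → (b r c < b r' c ↔ b r c' < b r' c') → False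
  c6 : ∀ r1 r2 r3 c12 c23 c31, R r1 c12 → R r2 c12 → R r2 c23 → R r3 c23 → R r3 c31 → R r1 c31 →
    r1 ≠ r2 → r2 ≠ r3 → r3 ≠ r1 → c12 ≠ c23 → c23 ≠ c31 → c31 ≠ c12 →
    (cyc r1 r2 r3 ↔ maj (a r1 c12 < a r1 c31) (a r2 c23 < a r2 c12) (a r3 c31 < a r3 c23)) →
    (cyc c12 c23 c31 ↔ maj (b r2 c12 < b r1 c12) (b r3 c23 < b r2 c23) (b r1 c31 < b r3 c31)) →
    False

lemma cyc_rot (a b c : ℕ) : cyc a b c ↔ cyc b c a := by unfold cyc; omega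
lemma cyc_anti (a b c : ℕ) (h1 : a ≠ b) (h2 : b ≠ c) (h3 : c ≠ a) : cyc b a c ↔ ¬ cyc a b c := by
  unfold cyc; omega

namespace Pat
def swap (P : Pat) : Pat where
  R := fun r c => P.R c r
  a := fun r c => P.b c r
  b := fun r c => P.a c r
  ane := fun r c c' h h' hn => P.bne c c' r h h' hn
  bne := fun r r' c h h' hn => P.ane c r r' h h' hn
  c4 := fun r r' c c' h1 h2 h3 h4 hn hn' hg hg' => P.c4 c c' r r' h1 h3 h2 h4 hn' hn hg' hg
  c6 := fun c1 c2 c3 r12 r23 r31 h1 h2 h3 h4 h5 h6 n1 n2 n3 m1 m2 m3 hg hg' =>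
    P.c6 r31 r12 r23 c1 c2 c3 h6 h1 h2 h3 h4 h5 m3 m1 m2 n1 n2 n3
      (by rw [cyc_rot, hg']; unfold maj; tauto) (by rw [hg])

variable (P : Pat)

/-- class of rows for columns A B -/
def Cl (A B r : ℕ) : Prop := P.R r A ∧ P.R r B ∧ P.a r A < P.a r B

lemma cl_rev {A B r r' : ℕ} (hAB : A ≠ B) (h : P.Cl A B r) (h' : P.Cl A B r')
    (hl : P.b r A < P.b r' A) : P.b r' B < P.b r B := by
  have hne : r ≠ r' := by rintro rfl; omega
  have := P.bne r r' B h.2.1 h'.2.1 hne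
  have := P.c4 r r' A B h.1 h.2.1 h'.1 h'.2.1 hne hAB (by have := h.2.2; have := h'.2.2; tauto)
  by_contra hc
  exact this ⟨fun _ => by omega, fun _ => hl⟩

lemma loc {A B b d j : ℕ} (hAB : A ≠ B) (hb : P.Cl A B b) (hd : P.Cl A B d)
    (hbd : P.b b A < P.b d A) (hjA : j ≠ A) (hjB : j ≠ B) (hbj : P.R b j) (hdj : P.R d j) :
    ∃ π : Prop, ∀ x, P.Cl A B x →
      (P.b b A < P.b x A → P.b x A < P.b d A → (cyc b x d ↔ π)) ∧
      (cyc A B j → P.b x A < P.b b A → (cyc b x d ↔ π)) ∧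
      (¬ cyc A B j → P.b d A < P.b x A → (cyc b x d ↔ π)) := by
  refine ⟨((cyc A B j ↔ P.b b j < P.b d j) ∧ ¬ (P.a b A < P.a b j ∧ P.a d j < P.a d B)) ∨
    (¬ (cyc A B j ↔ P.b b j < P.b d j) ∧ ¬ (P.a b B < P.a b j ∨ P.a d j < P.a d A)), fun x hx => ?_⟩
  by_cases hxb : x = b
  · subst hxb; exact ⟨fun h => by omega, fun _ h => by omega, fun _ h => by omega⟩
  by_cases hxd : x = d
  · subst hxd; exact ⟨fun _ h => by omega, fun _ h => by omega, fun _ h => by omega⟩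
  have hbd' : b ≠ d := by rintro rfl; omega
  have k1 := P.c6 b x d A B j hb.1 hx.1 hx.2.1 hd.2.1 hdj hbj (Ne.symm hxb) hxd hbd'.symm
    hAB hjB.symm hjA
  have k2 := P.c6 b x d B A j hb.2.1 hx.2.1 hx.1 hd.1 hdj hbj (Ne.symm hxb) hxd hbd'.symm
    hAB.symm hjA.symm hjB
  rw [cyc_anti A B j hAB hjB.symm hjA] at k2
  have ha := hx.2.2
  have ha' : ¬ (P.a x B < P.a x A) := by omega
  have nb := P.bne x b A hx.1 hb.1 hxb
  have nd := P.bne x d A hx.1 hd.1 hxd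
  have nb' := P.bne x b B hx.2.1 hb.2.1 hxb
  have nd' := P.bne x d B hx.2.1 hd.2.1 hxd
  have rv1 := P.cl_rev hAB hb hx
  have rv2 := P.cl_rev hAB hx hb
  have rv3 := P.cl_rev hAB hd hx
  have rv4 := P.cl_rev hAB hx hd
  have t1 : (P.b x B < P.b b B) ↔ P.b b A < P.b x A := by omega
  have t2 : (P.b d B < P.b x B) ↔ P.b x A < P.b d A := by omega
  have t3 : (P.b d A < P.b x A) ↔ ¬ P.b x A < P.b d A := by omega
  have t4 : (P.b b A < P.b x A) ↔ ¬ P.b x A < P.b b A := by omega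
  have t5 : P.b x A < P.b b A → P.b x A < P.b d A := by omega
  rw [t2] at k1
  rw [t1, t4, t3] at k2
  rw [t3, t4]
  simp only [ha, ha'] at k1 k2
  clear rv1 rv2 rv3 rv4 t1 t2 t3 t4 nb nd nb' nd' ha ha'
  generalize cyc A B j = o at *
  generalize cyc b x d = z at *
  generalize (P.b x A < P.b b A) = xb at *
  generalize (P.b x A < P.b d A) = xd at *
  generalize (P.b b j < P.b d j) = J at *
  generalize (P.a b A < P.a b j) = p at *
  generalize (P.a b B < P.a b j) = p' at *
  generalize (P.a d j < P.a d A) = q' at *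
  generalize (P.a d j < P.a d B) = q at *
  clear hx hxb hxd hb hd hbj hdj hjA hjB hbd hbd' hAB
  unfold maj at *
  by_cases o <;> by_cases J <;> by_cases xb <;> by_cases xd <;> simp_all <;> tauto

lemma cyc5a (C : ℕ → ℕ → ℕ → Prop) (rot : ∀ a b c, C a b c → C b c a)
    (tr : ∀ a b c d, C a b c → C a c d → C a b d ∧ C b c d)
    (tot : ∀ a b c, a ≠ b → b ≠ c → c ≠ a → ¬ C a b c → C a c b)
    (asy : ∀ a b c, C a b c → ¬ C a c b)
    {x0 x1 x2 x3 x4 : ℕ} (h01 : x0 ≠ x1) (h02 : x0 ≠ x2) (h03 : x0 ≠ x3)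
    (h12 : x1 ≠ x2) (h14 : x1 ≠ x4) (h13 : x1 ≠ x3) (h23 : x2 ≠ x3) (h24 : x2 ≠ x4)
    (k1 : C x0 x1 x3 ↔ C x0 x2 x3) (k2 : C x0 x1 x4 ↔ C x0 x2 x4)
    (k3 : C x0 x2 x4 ↔ C x0 x3 x4) (k4 : C x1 x2 x4 ↔ C x1 x3 x4)
    (k5 : (C x1 x2 x3 ↔ C x1 x0 x3) ∨ (C x1 x2 x3 ↔ C x1 x4 x3)) (h : C x0 x1 x4) : False := by
  have c24 := k2.1 h
  have c34 := k3.1 c24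
  by_cases c13 : C x0 x1 x3
  · have c23 := k1.1 c13
    have d134 := (tr _ _ _ _ c13 c34).2
    have d124 := k4.2 d134
    have e := (tr x4 x0 x1 x2 (rot _ _ _ (rot _ _ _ h)) (rot _ _ _ (rot _ _ _ d124))).2
    have f := (tr _ _ _ _ e c23).2
    have g1 := asy _ _ _ (rot _ _ _ c13)
    have g2 := asy _ _ _ d134
    tauto
  · have c32 := tot _ _ _ h02 h23 h03.symm (fun h => c13 (k1.2 h))
    have c31 := tot _ _ _ h01 h13 h03.symm c13
    have d314 := (tr _ _ _ _ c31 h).2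
    have d143 := rot _ _ _ d314
    have d124 : ¬ C x1 x2 x4 := fun hh => asy _ _ _ d143 (k4.1 hh)
    have d142 := tot _ _ _ h12 h24 h14.symm d124
    have e021 : C x0 x2 x1 := by
      apply tot _ _ _ h01 h12 h02.symm
      intro e
      exact d124 (tr _ _ _ _ e c24).2
    have f := (tr _ _ _ _ c32 e021).2
    have g := asy _ _ _ (rot _ _ _ (rot _ _ _ f))
    have g1 := rot _ _ _ (rot _ _ _ c31)
    tauto

lemma cyc_tr (a b c d : ℕ) (h : cyc a b c) (h' : cyc a c d) : cyc a b d ∧ cyc b c d := by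
  unfold cyc at *; omega

lemma cyc_tot (a b c : ℕ) (h1 : a ≠ b) (h2 : b ≠ c) (h3 : c ≠ a) (h : ¬ cyc a b c) :
    cyc a c b := by
  unfold cyc at *; omega

lemma cyc_asy (a b c : ℕ) (h : cyc a b c) : ¬ cyc a c b := by
  unfold cyc at *; omega

lemma cyc5 {x0 x1 x2 x3 x4 : ℕ} (h01 : x0 ≠ x1) (h02 : x0 ≠ x2) (h03 : x0 ≠ x3) (h04 : x0 ≠ x4)
    (h12 : x1 ≠ x2) (h13 : x1 ≠ x3) (h14 : x1 ≠ x4) (h23 : x2 ≠ x3) (h24 : x2 ≠ x4) (h34 : x3 ≠ x4)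
    (k1 : cyc x0 x1 x3 ↔ cyc x0 x2 x3) (k2 : cyc x0 x1 x4 ↔ cyc x0 x2 x4)
    (k3 : cyc x0 x2 x4 ↔ cyc x0 x3 x4) (k4 : cyc x1 x2 x4 ↔ cyc x1 x3 x4)
    (k5 : (cyc x1 x2 x3 ↔ cyc x1 x0 x3) ∨ (cyc x1 x2 x3 ↔ cyc x1 x4 x3)) : False := by
  by_cases h : cyc x0 x1 x4
  · exact cyc5a cyc (fun a b c => (cyc_rot a b c).1) cyc_tr cyc_tot cyc_asy h01 h02 h03 h12 h14
      h13 h23 h24 k1 k2 k3 k4 k5 h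
  · have fl : ∀ a b c, a ≠ b → b ≠ c → c ≠ a → (cyc a c b ↔ ¬ cyc a b c) := fun a b c e1 e2 e3 =>
      ⟨fun h h' => cyc_asy _ _ _ h h', cyc_tot a b c e1 e2 e3⟩
    have f1 := fl x0 x1 x3 h01 h13 h03.symm
    have f2 := fl x0 x2 x3 h02 h23 h03.symm
    have f3 := fl x0 x1 x4 h01 h14 h04.symm
    have f4 := fl x0 x2 x4 h02 h24 h04.symm
    have f5 := fl x0 x3 x4 h03 h34 h04.symm
    have f6 := fl x1 x2 x4 h12 h24 h14.symm
    have f7 := fl x1 x3 x4 h13 h34 h14.symm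
    have f8 := fl x1 x2 x3 h12 h23 h13.symm
    have f9 := fl x1 x0 x3 h01.symm h03 h13.symm
    have f10 := fl x1 x4 x3 h14 h34.symm h13.symm
    refine cyc5a (fun a b c => cyc a c b) (fun a b c h => ?_) (fun a b c d h h' => ?_)
      (fun a b c e1 e2 e3 h => ?_) (fun a b c h => cyc_asy _ _ _ h) h01 h02 h03 h12 h14
      h13 h23 h24 ?_ ?_ ?_ ?_ ?_ ?_
    · exact (cyc_rot _ _ _).1 ((cyc_rot _ _ _).1 h)
    · have := cyc_tr _ _ _ _ h' h
      exact ⟨this.1, (cyc_rot _ _ _).1 ((cyc_rot _ _ _).1 this.2)⟩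
    · exact cyc_tot _ _ _ e3.symm e2.symm e1.symm h
    · rw [f1, f2, k1]
    · rw [f3, f4, k2]
    · rw [f4, f5, k3]
    · rw [f6, f7, k4]
    · rw [f8, f9, f10]
      exact k5.imp (fun k => by rw [k]) (fun k => by rw [k])
    · exact f3.2 h

lemma five {A B x0 x1 x2 x3 x4 : ℕ} (hAB : A ≠ B) (h0 : P.Cl A B x0) (h1 : P.Cl A B x1)
    (h2 : P.Cl A B x2) (h3 : P.Cl A B x3) (h4 : P.Cl A B x4)
    (l1 : P.b x0 A < P.b x1 A) (l2 : P.b x1 A < P.b x2 A) (l3 : P.b x2 A < P.b x3 A)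
    (l4 : P.b x3 A < P.b x4 A)
    (Q : ℕ → Prop) (q0 : Q x0) (q1 : Q x1) (q3 : Q x3) (q4 : Q x4)
    (hh : ∀ r r', Q r → Q r' → r ≠ r' → ∃ j, j ≠ A ∧ j ≠ B ∧ P.R r j ∧ P.R r' j) :
    False := by
  have L : ∀ b d, Q b → Q d → P.Cl A B b → P.Cl A B d → P.b b A < P.b d A →
      ∃ π o : Prop, ∀ x, P.Cl A B x →
      (P.b b A < P.b x A → P.b x A < P.b d A → (cyc b x d ↔ π)) ∧
      (o → P.b x A < P.b b A → (cyc b x d ↔ π)) ∧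
      (¬ o → P.b d A < P.b x A → (cyc b x d ↔ π)) := by
    intro b d qb qd hb hd hbd
    obtain ⟨j, j1, j2, j3, j4⟩ := hh b d qb qd (by rintro rfl; omega)
    obtain ⟨π, hπ⟩ := P.loc hAB hb hd hbd j1 j2 j3 j4
    exact ⟨π, _, hπ⟩
  obtain ⟨π03, o, h03⟩ := L x0 x3 q0 q3 h0 h3 (by omega)
  obtain ⟨π04, o, h04⟩ := L x0 x4 q0 q4 h0 h4 (by omega)
  obtain ⟨π14, o, h14⟩ := L x1 x4 q1 q4 h1 h4 (by omega)
  obtain ⟨π13, o, h13⟩ := L x1 x3 q1 q3 h1 h3 (by omega)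
  have ne : ∀ x y, P.b x A < P.b y A → x ≠ y := by rintro x y h rfl; omega
  refine cyc5 (ne x0 x1 (by omega)) (ne x0 x2 (by omega)) (ne x0 x3 (by omega))
    (ne x0 x4 (by omega)) (ne x1 x2 (by omega)) (ne x1 x3 (by omega)) (ne x1 x4 (by omega))
    (ne x2 x3 (by omega)) (ne x2 x4 (by omega)) (ne x3 x4 (by omega)) ?_ ?_ ?_ ?_ ?_
  · rw [(h03 x1 h1).1 (by omega) (by omega), (h03 x2 h2).1 (by omega) (by omega)]
  · rw [(h04 x1 h1).1 (by omega) (by omega), (h04 x2 h2).1 (by omega) (by omega)]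
  · rw [(h04 x3 h3).1 (by omega) (by omega), (h04 x2 h2).1 (by omega) (by omega)]
  · rw [(h14 x3 h3).1 (by omega) (by omega), (h14 x2 h2).1 (by omega) (by omega)]
  · rw [(h13 x2 h2).1 (by omega) (by omega)]
    by_cases ho : o
    · exact Or.inl ((h13 x0 h0).2.1 ho (by omega)).symm
    · exact Or.inr ((h13 x4 h4).2.2 ho (by omega)).symm

end Pat
end LC

namespace LC
namespace Pat
open Finset
variable (P : Pat)

lemma noLight {A B : ℕ} (hAB : A ≠ B) (T : Finset ℕ) (hT : ∀ r ∈ T, P.Cl A B r)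
    (hh : ∀ r r', r ∈ T → r' ∈ T → r ≠ r' → ∃ j, j ≠ A ∧ j ≠ B ∧ P.R r j ∧ P.R r' j) :
    T.card ≤ 4 := by
  by_contra hc
  have inj : Set.InjOn (fun r => P.b r A) T := by
    intro r hr r' hr' h
    by_contra hne
    exact P.bne r r' A (hT r hr).1 (hT r' hr').1 hne h
  have hcard : 5 ≤ (T.image (fun r => P.b r A)).card := by
    rw [card_image_of_injOn inj]; omega
  let f := (T.image (fun r => P.b r A)).orderEmbOfCardLe hcard
  have hf : ∀ i, ∃ r ∈ T, P.b r A = f i := fun i => by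
    have := (T.image (fun r => P.b r A)).orderEmbOfCardLe_mem hcard i
    simpa using this
  choose x hx hxf using hf
  have hlt : ∀ i j : Fin 5, i < j → P.b (x i) A < P.b (x j) A := by
    intro i j hij
    rw [hxf, hxf]
    exact f.strictMono hij
  exact P.five hAB (hT _ (hx 0)) (hT _ (hx 1)) (hT _ (hx 2)) (hT _ (hx 3)) (hT _ (hx 4))
    (hlt 0 1 (by decide)) (hlt 1 2 (by decide)) (hlt 2 3 (by decide)) (hlt 3 4 (by decide))
    (· ∈ T) (hx 0) (hx 1) (hx 3) (hx 4) hh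

def LP (A B : ℕ) (q : ℕ × ℕ) : Prop := ∀ j, P.R q.1 j → P.R q.2 j → j = A ∨ j = B

open Classical in
lemma clCount {A B : ℕ} (hAB : A ≠ B) (T : Finset ℕ) (hT : ∀ r ∈ T, P.Cl A B r) :
    2 * T.card ≤ 8 + (T.offDiag.filter (P.LP A B)).card := by
  induction h : T.card using Nat.strong_induction_on generalizing T with
  | _ n ih =>
    by_cases hl : ∃ r ∈ T, ∃ r' ∈ T, r ≠ r' ∧ P.LP A B (r, r')
    · obtain ⟨r, hr, r', hr', hne, hlp⟩ := hl
      have hpos : 0 < T.card := card_pos.2 ⟨r, hr⟩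
      have h1 := ih (T.card - 1) (by omega) (T.erase r)
        (fun x hx => hT x (mem_of_mem_erase hx)) (card_erase_of_mem hr)
      have h2 : ((T.erase r).offDiag.filter (P.LP A B)).card + 2 ≤
          (T.offDiag.filter (P.LP A B)).card := by
        have e : ({(r, r'), (r', r)} : Finset (ℕ × ℕ)).card = 2 := by
          rw [card_pair]; simp; tauto
        rw [← e, ← card_union_of_disjoint]
        · apply card_le_card
          intro q hq
          simp only [mem_union, mem_filter, mem_offDiag, mem_erase, mem_insert,
            mem_singleton] at hq ⊢
          rcases hq with hq | rfl | rfl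
          · tauto
          · exact ⟨⟨hr, hr', hne⟩, hlp⟩
          · exact ⟨⟨hr', hr, hne.symm⟩, fun j h1 h2 => hlp j h2 h1⟩
        · rw [Finset.disjoint_left]
          intro q hq hq'
          simp only [mem_filter, mem_offDiag, mem_erase, mem_insert, mem_singleton] at hq hq'
          rcases hq' with rfl | rfl <;> simp at hq
      omega
    · have := P.noLight hAB T hT (fun r r' hr hr' hne => by
        by_contra hc
        apply hl
        refine ⟨r, hr, r', hr', hne, fun j h1 h2 => ?_⟩
        by_contra hj
        exact hc ⟨j, by tauto, by tauto, h1, h2⟩)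
      omega

open Classical in
noncomputable def NR (m A B : ℕ) : Finset ℕ := (range m).filter (fun r => P.R r A ∧ P.R r B)

open Classical in
noncomputable def lam (m : ℕ) : ℕ :=
  ((range m).offDiag.filter (fun q => (P.NR m q.1 q.2).card = 2)).card

noncomputable def NX (m : ℕ) : ℕ := ∑ q ∈ (range m).offDiag, (P.NR m q.1 q.2).card

open Classical in
noncomputable def ell (m A B : ℕ) : ℕ :=
  ((range m).offDiag.filter (fun q => (P.swap.NR m q.1 q.2).card = 2 ∧
    (A ∈ P.swap.NR m q.1 q.2 ∧ B ∈ P.swap.NR m q.1 q.2))).card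

open Classical in
lemma nBound {m A B : ℕ} (hA : A < m) (hB : B < m) (hAB : A ≠ B) :
    2 * (P.NR m A B).card ≤ 16 + P.ell m A B := by
  set T1 := (P.NR m A B).filter (fun r => P.a r A < P.a r B)
  set T2 := (P.NR m A B).filter (fun r => ¬ P.a r A < P.a r B)
  have hc : T1.card + T2.card = (P.NR m A B).card := card_filter_add_card_filter_not _
  have hm : ∀ r, r ∈ P.NR m A B ↔ r < m ∧ P.R r A ∧ P.R r B := by simp [NR]
  have c1 := P.clCount hAB T1 (fun r hr => by
    simp only [T1, mem_filter, hm] at hr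
    exact ⟨hr.1.2.1, hr.1.2.2, hr.2⟩)
  have c2 := P.clCount hAB.symm T2 (fun r hr => by
    simp only [T2, mem_filter, hm] at hr
    have := P.ane r A B hr.1.2.1 hr.1.2.2 hAB
    exact ⟨hr.1.2.2, hr.1.2.1, by omega⟩)
  have hd : (T1.offDiag.filter (P.LP A B)).card + (T2.offDiag.filter (P.LP B A)).card ≤
      P.ell m A B := by
    rw [← card_union_of_disjoint]
    · apply card_le_card
      intro q hq
      have key : q.1 ∈ P.NR m A B ∧ q.2 ∈ P.NR m A B ∧ q.1 ≠ q.2 ∧ P.LP A B q := by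
        simp only [T1, T2, mem_union, mem_filter, mem_offDiag] at hq
        rcases hq with hq | hq
        · tauto
        · exact ⟨hq.1.1.1, hq.1.2.1.1, hq.1.2.2, fun j h1 h2 => (hq.2 j h1 h2).symm⟩
      obtain ⟨k1, k2, k3, k4⟩ := key
      rw [hm] at k1 k2
      have : P.swap.NR m q.1 q.2 = {A, B} := by
        ext j
        have hs : j ∈ P.swap.NR m q.1 q.2 ↔ j < m ∧ P.R q.1 j ∧ P.R q.2 j := by
          unfold NR
          rw [mem_filter, mem_range]
          rfl
        rw [hs, mem_insert, mem_singleton]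
        constructor
        · rintro ⟨h1, h2, h3⟩; exact k4 j h2 h3
        · rintro (rfl | rfl)
          · exact ⟨hA, k1.2.1, k2.2.1⟩
          · exact ⟨hB, k1.2.2, k2.2.2⟩
      simp only [mem_filter, mem_offDiag, mem_range, this]
      refine ⟨⟨k1.1, k2.1, k3⟩, card_pair hAB, by simp, by simp⟩
    · rw [Finset.disjoint_left]
      intro q hq hq'
      simp only [T1, T2, mem_filter, mem_offDiag] at hq hq'
      tauto
  omega

open Classical in
lemma sum_ell (m : ℕ) : ∑ q ∈ (range m).offDiag, P.ell m q.1 q.2 = 2 * P.swap.lam m := by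
  simp only [ell, lam, card_filter]
  rw [sum_comm, mul_sum]
  apply sum_congr rfl
  intro p hp
  rw [← card_filter]
  by_cases h : (P.swap.NR m p.1 p.2).card = 2
  · simp only [h, true_and, if_true]
    have : (range m).offDiag.filter (fun q => q.1 ∈ P.swap.NR m p.1 p.2 ∧
        q.2 ∈ P.swap.NR m p.1 p.2) = (P.swap.NR m p.1 p.2).offDiag := by
      ext q
      simp only [mem_filter, mem_offDiag, NR, mem_range]
      tauto
    rw [this, offDiag_card, h]
    norm_num
  · simp [h]

open Classical in
lemma bound (m : ℕ) : P.NX m + 6 * P.lam m ≤ 8 * (m * m - m) + P.swap.lam m := by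
  have h1 : ∑ q ∈ (range m).offDiag, (2 * (P.NR m q.1 q.2).card +
      12 * (if (P.NR m q.1 q.2).card = 2 then 1 else 0)) ≤
      ∑ q ∈ (range m).offDiag, (16 + P.ell m q.1 q.2) := by
    apply sum_le_sum
    intro q hq
    simp only [mem_offDiag, mem_range] at hq
    have := P.nBound hq.1 hq.2.1 hq.2.2
    split_ifs <;> omega
  rw [sum_add_distrib, sum_add_distrib, P.sum_ell, ← mul_sum, ← mul_sum, ← card_filter,
    sum_const, offDiag_card, card_range] at h1
  unfold NX lam
  simp only [smul_eq_mul] at h1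
  unfold lam at h1
  omega

open Classical in
noncomputable def ee (m : ℕ) : ℕ := ∑ r ∈ range m, ((range m).filter (fun c => P.R r c)).card

open Classical in
lemma ee_swap (m : ℕ) : P.swap.ee m = P.ee m := by
  unfold ee
  simp only [card_filter]
  rw [sum_comm]
  rfl

open Classical in
lemma cs (m : ℕ) : P.ee m ^ 2 ≤ m * (P.NX m + P.ee m) := by
  have h : P.NX m + P.ee m = ∑ r ∈ range m, ((range m).filter (fun c => P.R r c)).card ^ 2 := by
    simp only [NX, ee, NR, card_filter]
    rw [sum_comm, ← sum_add_distrib]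
    apply sum_congr rfl
    intro r hr
    rw [← card_filter, ← card_filter]
    have : (range m).offDiag.filter (fun q => P.R r q.1 ∧ P.R r q.2) =
        ((range m).filter (fun c => P.R r c)).offDiag := by
      ext q
      simp only [mem_filter, mem_offDiag, mem_range]
      tauto
    rw [this, offDiag_card, pow_two]
    have := Nat.le_mul_self ((range m).filter (fun c => P.R r c)).card
    omega
  rw [h]
  have := sq_sum_le_card_mul_sum_sq (s := range m)
    (f := fun r => ((range m).filter (fun c => P.R r c)).card)
  simpa [ee] using this

lemma final (m : ℕ) : P.ee m ^ 2 ≤ m * (8 * (m * m - m) + P.ee m) := by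
  have h1 := P.cs m
  have h2 := P.swap.cs m
  have b1 := P.bound m
  have b2 := P.swap.bound m
  rw [P.ee_swap] at h2
  have : P.swap.swap.lam m = P.lam m := rfl
  rw [this] at b2
  have h3 : P.NX m + P.swap.NX m ≤ 16 * (m * m - m) := by omega
  nlinarith [Nat.mul_le_mul_left m h3]
end Pat

lemma real_final {m e k : ℕ} (hm : 1 ≤ m) (h : e ^ 2 ≤ m * (8 * (m * m - m) + e))
    (hk : k ≤ e + m) :
    (k : ℝ) ≤ Real.sqrt 10 * (m : ℝ) ^ ((3 : ℝ) / 2) + (m : ℝ) / 2 := by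
  have h' : (e : ℝ) ^ 2 ≤ m * (8 * (m * m - m) + e) := by
    have : m ≤ m * m := Nat.le_mul_self m
    have := (Nat.cast_le (α := ℝ)).2 h
    push_cast [Nat.cast_sub ‹m ≤ m * m›] at this
    exact this
  have hk' : (k : ℝ) ≤ e + m := by exact_mod_cast hk
  have hm' : (1 : ℝ) ≤ m := by exact_mod_cast hm
  set u := Real.sqrt m with hu
  have hu1 : 1 ≤ u := by rw [hu]; exact Real.one_le_sqrt.2 hm'
  have hmu : (m : ℝ) = u ^ 2 := by rw [hu, Real.sq_sqrt (by linarith)]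
  have hpow : (m : ℝ) ^ ((3 : ℝ) / 2) = u ^ 3 := by
    rw [hu, Real.sqrt_eq_rpow, ← Real.rpow_natCast, ← Real.rpow_mul (by linarith)]
    norm_num
  set w := Real.sqrt 10 with hw
  have hw2 : w ^ 2 = 10 := by rw [hw, Real.sq_sqrt (by norm_num)]
  have hw0 : 0 ≤ w := Real.sqrt_nonneg _
  rw [hmu] at h' hk'
  rw [hpow, hmu]
  suffices h : (e : ℝ) ≤ w * u ^ 3 - u ^ 2 / 2 by linarith
  by_contra hc
  push Not at hc
  have hw3 : 3 ≤ w := by rw [hw]; exact Real.le_sqrt_of_sq_le (by norm_num)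
  have hu3 : u ^ 2 ≤ u ^ 3 := by nlinarith [sq_nonneg u]
  have q0 : 0 < e - u ^ 2 / 2 - (w * u ^ 3 - u ^ 2) := by linarith
  -- (e - u²/2)² > (w u³ - u²)²
  have q1 : (w * u ^ 3 - u ^ 2) ^ 2 < ((e : ℝ) - u ^ 2 / 2) ^ 2 := by
    apply pow_lt_pow_left₀ (by linarith) (by nlinarith) (by norm_num)
  have q2 : ((e : ℝ) - u ^ 2 / 2) ^ 2 ≤ 8 * u ^ 6 - 8 * u ^ 4 + u ^ 4 / 4 := by nlinarith
  have q3 : (w * u ^ 3 - u ^ 2) ^ 2 = 10 * u ^ 6 - 2 * w * u ^ 5 + u ^ 4 := by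
    have : (w * u ^ 3 - u ^ 2) ^ 2 = w ^ 2 * u ^ 6 - 2 * w * u ^ 5 + u ^ 4 := by ring
    rw [this, hw2]
  have q4 : 0 ≤ u ^ 4 * (2 * u ^ 2 - 2 * w * u + 35 / 4) := by
    apply mul_nonneg (by positivity)
    nlinarith [sq_nonneg (2 * u - w)]
  nlinarith
end LC

namespace LC
namespace Sys
variable {V ι : Type*} {G : SimpleGraph V} (S : Sys G ι)

open Classical in
noncomputable def av (f : ι → ℕ) (r c : ℕ) : ℕ :=
  if h : ∃ t, S.ρ t = r ∧ S.κ t = c then f h.choose else 0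

lemma av_eq (f : ι → ℕ) (t : ι) : S.av f (S.ρ t) (S.κ t) = f t := by
  have h : ∃ t', S.ρ t' = S.ρ t ∧ S.κ t' = S.κ t := ⟨t, rfl, rfl⟩
  unfold av
  rw [dif_pos h, S.rc_inj h.choose_spec.1 h.choose_spec.2]

lemma av_eq' (f : ι → ℕ) {t : ι} {r c : ℕ} (hr : S.ρ t = r) (hc : S.κ t = c) :
    S.av f r c = f t := by
  subst hr hc; exact S.av_eq f t

noncomputable def pat : Pat where
  R := fun r c => ∃ t, S.ρ t = r ∧ S.κ t = c
  a := S.av S.α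
  b := S.av S.β
  ane := by
    rintro r c c' ⟨t, h1, h2⟩ ⟨t', h1', h2'⟩ hne
    rw [S.av_eq' _ h1 h2, S.av_eq' _ h1' h2']
    intro h
    have := S.αinj _ _ h
    subst this
    omega
  bne := by
    rintro r r' c ⟨t, h1, h2⟩ ⟨t', h1', h2'⟩ hne
    rw [S.av_eq' _ h1 h2, S.av_eq' _ h1' h2']
    intro h
    have := S.βinj _ _ h
    subst this
    omega
  c4 := by
    rintro r r' c c' ⟨t1, a1, b1⟩ ⟨t2, a2, b2⟩ ⟨t3, a3, b3⟩ ⟨t4, a4, b4⟩ hr hc h h'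
    rw [S.av_eq' _ a1 b1, S.av_eq' _ a2 b2, S.av_eq' _ a3 b3, S.av_eq' _ a4 b4] at h h'
    exact S.C4 (t1 := t1) (t2 := t2) (s1 := t3) (s2 := t4) (by omega) (by omega) (by omega)
      (by omega) (by omega) (by omega) h h'
  c6 := by
    rintro r1 r2 r3 c12 c23 c31 ⟨t1, a1, b1⟩ ⟨t2, a2, b2⟩ ⟨t3, a3, b3⟩ ⟨t4, a4, b4⟩ ⟨t5, a5, b5⟩
      ⟨t6, a6, b6⟩ n1 n2 n3 m1 m2 m3 h h'
    rw [S.av_eq' _ a1 b1, S.av_eq' _ a2 b2, S.av_eq' _ a3 b3, S.av_eq' _ a4 b4, S.av_eq' _ a5 b5,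
      S.av_eq' _ a6 b6] at h h'
    refine S.C6 (u12 := t1) (u21 := t2) (u23 := t3) (u32 := t4) (u31 := t5) (u13 := t6)
      (by omega) (by omega) (by omega) (by omega) (by omega) (by omega) (by omega) (by omega)
      (by omega) (by omega) (by omega) (by omega) ?_ ?_
    · rw [a1, a3, a5]; exact h
    · rw [b1, b3, b5]; exact h'

open Classical in
lemma card_le [Fintype ι] (m : ℕ) (hρ : ∀ t, S.ρ t < m) (hκ : ∀ t, S.κ t < m) :
    Fintype.card ι ≤ S.pat.ee m := by
  unfold Pat.ee
  rw [← Finset.card_univ, Finset.card_eq_sum_card_fiberwise (f := S.ρ) (t := Finset.range m)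
    (fun t _ => by simpa using hρ t)]
  apply Finset.sum_le_sum
  intro r hr
  apply Finset.card_le_card_of_injOn S.κ
  · intro t ht
    simp only [Finset.coe_filter, Finset.mem_univ, true_and, Set.mem_ofPred_eq] at ht
    simp only [Finset.coe_filter, Set.mem_ofPred_eq, Finset.mem_range]
    exact ⟨hκ t, t, ht, rfl⟩
  · intro t ht t' ht' h
    simp only [Finset.coe_filter, Finset.mem_univ, true_and, Set.mem_ofPred_eq] at ht ht'
    exact S.rc_inj (ht.trans ht'.symm) h
end Sys

section cnt
variable {V : Type*}
open Finset Classical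

noncomputable def cnt (f : ℕ → V) (Q : V → Prop) (i : ℕ) : ℕ :=
  ((range (i + 1)).filter (fun j => Q (f j))).card

lemma cnt_mono (f : ℕ → V) (Q : V → Prop) {i j : ℕ} (h : i ≤ j) : cnt f Q i ≤ cnt f Q j := by
  apply card_le_card
  apply filter_subset_filter
  intro x hx
  simp only [mem_range] at *; omega

lemma cnt_pos (f : ℕ → V) (Q : V → Prop) (h : Q (f 0)) (i : ℕ) : 0 < cnt f Q i := by
  apply card_pos.2
  exact ⟨0, by simp [h]⟩

lemma cnt_lt (f : ℕ → V) (Q : V → Prop) {i j k : ℕ} (h : i < k) (h' : k ≤ j) (hQ : Q (f k)) :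
    cnt f Q i < cnt f Q j := by
  apply card_lt_card
  rw [ssubset_iff_of_subset]
  · refine ⟨k, ?_, ?_⟩
    · simp only [mem_filter, mem_range]; exact ⟨by omega, hQ⟩
    · simp only [mem_filter, mem_range]; omega
  · apply filter_subset_filter
    intro x hx
    simp only [mem_range] at *; omega

lemma cnt_le (f : ℕ → V) (Q : V → Prop) {i n : ℕ} (hi : i < n)
    (hinj : ∀ i j, i < n → j < n → f i = f j → i = j) (M : Finset V)
    (hM : ∀ i, Q (f i) → f i ∈ M) : cnt f Q i ≤ M.card := by
  apply card_le_card_of_injOn f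
  · intro x hx
    simp only [coe_filter, mem_range, Set.mem_ofPred_eq] at hx
    exact hM x hx.2
  · intro x hx y hy h
    simp only [coe_filter, mem_range, Set.mem_ofPred_eq] at hx hy
    exact hinj x y (by omega) (by omega) h
end cnt

section walks
variable {V : Type*} {G : SimpleGraph V}

lemma cyc_adj {v : V} {C : G.Walk v v} (i : ℕ) (hi : i + 1 < C.length) :
    G.Adj (C.getVert i) (C.getVert (i + 1)) := C.adj_getVert_succ (by omega)

lemma cyc_close {v : V} {C : G.Walk v v} (hC : C.IsCycle) :
    G.Adj (C.getVert (C.length - 1)) (C.getVert 0) := by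
  have h3 := hC.three_le_length
  have := C.adj_getVert_succ (i := C.length - 1) (by omega)
  rw [show C.length - 1 + 1 = C.length by omega, Walk.getVert_length] at this
  simpa using this

lemma cyc_inj {v : V} {C : G.Walk v v} (hC : C.IsCycle) (i j : ℕ) (hi : i < C.length)
    (hj : j < C.length) (h : C.getVert i = C.getVert j) : i = j :=
  hC.getVert_injOn' (by simp; omega) (by simp; omega) h

lemma cyc_surj {v : V} {C : G.Walk v v} (hC : C.IsCycle) {u : V} (hu : u ∈ C.support) :
    ∃ i < C.length, C.getVert i = u := by
  have h3 := hC.three_le_length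
  obtain ⟨i, hi, hle⟩ := Walk.mem_support_iff_exists_getVert.1 hu
  rcases Nat.lt_or_ge i C.length with h | h
  · exact ⟨i, h, hi⟩
  · have : i = C.length := by omega
    subst this
    refine ⟨0, by omega, ?_⟩
    rw [← hi]; simp

lemma int_exists {a b : V} (p : G.Walk a b) (hab : a ≠ b) : ∃ c, p.support = a :: (c ++ [b]) := by
  cases p with
  | nil => exact absurd rfl hab
  | cons h q =>
    refine ⟨q.support.dropLast, ?_⟩
    rw [Walk.support_cons]
    congr 1
    have := List.dropLast_append_getLast (Walk.support_ne_nil q)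
    rw [Walk.getLast_support] at this
    exact this.symm
end walks
end LC

namespace LC
section core
variable {V : Type*} [DecidableEq V] {G : SimpleGraph V}

open Classical in
lemma core {v : V} (X Y : G.Walk v v) (hX : X.IsCycle) (hY : Y.IsCycle)
    (hlen : Y.length = X.length)
    (hmax : ∀ (y : V) (W : G.Walk y y), W.IsCycle → W.length ≤ X.length)
    (k : ℕ) (a b : Fin k → V) (P : ∀ t, G.Walk (a t) (b t))
    (hP : ∀ t, IsABPath G
      ({v | v ∈ X.support} \ {v | v ∈ Y.support})
      ({v | v ∈ Y.support} \ {v | v ∈ X.support}) (P t))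
    (hdisj : ∀ s t, s ≠ t → ∀ v ∈ (P s).support, v ∉ (P t).support) :
    ∃ e : ℕ, e ^ 2 ≤ (X.support.toFinset ∩ Y.support.toFinset).card *
      (8 * ((X.support.toFinset ∩ Y.support.toFinset).card *
        (X.support.toFinset ∩ Y.support.toFinset).card -
        (X.support.toFinset ∩ Y.support.toFinset).card) + e) ∧
      k ≤ e + (X.support.toFinset ∩ Y.support.toFinset).card := by
  set M := X.support.toFinset ∩ Y.support.toFinset with hM
  have memM : ∀ u, u ∈ M ↔ u ∈ X.support ∧ u ∈ Y.support := by intro u; simp [hM]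
  let good : Fin k → Prop := fun t => ∀ u ∈ (P t).support, u ∉ M
  -- bad paths
  have hbad : (Finset.univ.filter (fun t => ¬ good t)).card ≤ M.card := by
    have hex : ∀ t : Fin k, ∃ u, ¬ good t → u ∈ (P t).support ∧ u ∈ M := by
      intro t
      by_cases h : good t
      · exact ⟨v, fun h' => absurd h h'⟩
      · have h' := h
        simp only [good, not_forall, not_not] at h'
        obtain ⟨u, h1, h2⟩ := h'
        exact ⟨u, fun _ => ⟨h1, h2⟩⟩
    choose f hf using hex
    apply Finset.card_le_card_of_injOn f
    · intro t ht
      simp only [Finset.coe_filter, Finset.mem_univ, true_and, Set.mem_ofPred_eq] at ht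
      exact (hf t ht).2
    · intro t ht t' ht' h
      simp only [Finset.coe_filter, Finset.mem_univ, true_and, Set.mem_ofPred_eq] at ht ht'
      by_contra hne
      exact hdisj t t' hne (f t) (hf t ht).1 (h ▸ (hf t' ht').1)
  have haX : ∀ t, a t ∈ X.support := fun t => (hP t).2.1.1
  have haY : ∀ t, a t ∉ Y.support := fun t => (hP t).2.1.2
  have hbY : ∀ t, b t ∈ Y.support := fun t => (hP t).2.2.1.1
  have hbX : ∀ t, b t ∉ X.support := fun t => (hP t).2.2.1.2
  have hab : ∀ t, a t ≠ b t := fun t h => hbX t (h ▸ haX t)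
  choose α hα hαa using fun t => cyc_surj hX (haX t)
  choose β hβ hβb using fun t => cyc_surj hY (hbY t)
  choose I hI using fun t => int_exists (P t) (hab t)
  have hnd : ∀ t, (a t :: (I t ++ [b t])).Nodup := fun t => by
    rw [← hI]; exact (hP t).1.support_nodup
  have hIsub : ∀ t, ∀ u ∈ I t, u ∈ (P t).support := fun t u hu => by rw [hI]; simp [hu]
  have hIa : ∀ t, a t ∉ I t := fun t h => by
    have := hnd t
    simp [h] at this
  have hIb : ∀ t, b t ∉ I t := fun t h => by
    have := hnd t
    simp [List.nodup_append] at this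
    exact this.2.2 _ h rfl
  have hIX : ∀ t, good t → ∀ u ∈ X.support, u ∉ I t := by
    intro t hg u hu h
    have h1 := hIsub t u h
    have h2 : u ∉ Y.support := fun h2 => hg u h1 ((memM u).2 ⟨hu, h2⟩)
    have := (hP t).2.2.2.1 u h1 ⟨hu, h2⟩
    exact hIa t (this ▸ h)
  have hIY : ∀ t, good t → ∀ u ∈ Y.support, u ∉ I t := by
    intro t hg u hu h
    have h1 := hIsub t u h
    have h2 : u ∉ X.support := fun h2 => hg u h1 ((memM u).2 ⟨h2, hu⟩)
    have := (hP t).2.2.2.2 u h1 ⟨hu, h2⟩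
    exact hIb t (this ▸ h)
  have posX : ∀ i, 0 < cnt X.getVert (· ∈ Y.support) i := cnt_pos _ _ (by simp)
  have posY : ∀ i, 0 < cnt Y.getVert (· ∈ X.support) i := cnt_pos _ _ (by simp)
  let S : Sys G {t // good t} :=
    { n := X.length
      X := X.getVert
      Y := Y.getVert
      hn := hX.three_le_length
      hmax := hmax
      Xadj := cyc_adj
      Xclose := cyc_close hX
      Xinj := cyc_inj hX
      Yadj := hlen ▸ cyc_adj
      Yclose := hlen ▸ cyc_close hY
      Yinj := hlen ▸ cyc_inj hY
      α := fun t => α t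
      β := fun t => β t
      ρ := fun t => cnt X.getVert (· ∈ Y.support) (α t) - 1
      κ := fun t => cnt Y.getVert (· ∈ X.support) (β t) - 1
      αlt := fun t => hα t
      βlt := fun t => hlen ▸ hβ t
      αinj := by
        intro s t h
        have e : a s = a t := by rw [← hαa, ← hαa, h]
        by_contra hne
        refine hdisj s t (fun h => hne (Subtype.ext h)) (a s) (Walk.start_mem_support _) ?_
        rw [e]; exact Walk.start_mem_support _
      βinj := by
        intro s t h
        have e : b s = b t := by rw [← hβb, ← hβb, h]
        by_contra hne
        refine hdisj s t (fun h => hne (Subtype.ext h)) (b s) (Walk.end_mem_support _) ?_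
        rw [e]; exact Walk.end_mem_support _
      ρmono := fun s t h => Nat.sub_le_sub_right (cnt_mono _ _ h) 1
      κmono := fun s t h => Nat.sub_le_sub_right (cnt_mono _ _ h) 1
      ρarc := by
        intro s t h i h1 h2 j hj hij
        have p1 := posX (α s)
        have p2 := posX (α t)
        have hi : X.getVert i ∈ Y.support := by rw [hij]; exact Walk.getVert_mem_support _ _
        rcases Nat.eq_or_lt_of_le h1 with e | e
        · rw [← e, hαa] at hi
          exact haY _ hi
        · have := cnt_lt X.getVert (· ∈ Y.support) e h2 hi
          omega
      κarc := by
        intro s t h i h1 h2 j hj hij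
        have p1 := posY (β s)
        have p2 := posY (β t)
        have hi : Y.getVert i ∈ X.support := by rw [hij]; exact Walk.getVert_mem_support _ _
        rcases Nat.eq_or_lt_of_le h1 with e | e
        · rw [← e, hβb] at hi
          exact hbX _ hi
        · have := cnt_lt Y.getVert (· ∈ X.support) e h2 hi
          omega
      I := fun t => I t
      Iconn := by
        intro t
        unfold Conn
        rw [hαa, hβb, ← hI]
        exact Walk.isChain_adj_support _
      Inodup := by
        intro t
        have := hnd t
        rw [List.nodup_cons, List.nodup_append'] at this
        exact this.2.1
      IX := fun t i _ => hIX t t.2 _ (Walk.getVert_mem_support _ _)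
      IY := fun t i _ => hIY t t.2 _ (Walk.getVert_mem_support _ _)
      Idisj := by
        intro s t h u hu hu'
        exact hdisj s t (fun h' => h (Subtype.ext h')) u (hIsub _ _ hu) (hIsub _ _ hu') }
  have hρ : ∀ t, S.ρ t < M.card := by
    intro t
    have h1 := posX (α t)
    have h2 := cnt_le X.getVert (· ∈ Y.support) (hα t) (cyc_inj hX) M
      (fun i h => (memM _).2 ⟨Walk.getVert_mem_support _ _, h⟩)
    show cnt X.getVert (· ∈ Y.support) (α t) - 1 < _
    omega
  have hκ : ∀ t, S.κ t < M.card := by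
    intro t
    have h1 := posY (β t)
    have h2 := cnt_le Y.getVert (· ∈ X.support) (hβ t) (cyc_inj hY) M
      (fun i h => (memM _).2 ⟨h, Walk.getVert_mem_support _ _⟩)
    show cnt Y.getVert (· ∈ X.support) (β t) - 1 < _
    omega
  refine ⟨S.pat.ee M.card, S.pat.final M.card, ?_⟩
  have h1 := S.card_le M.card hρ hκ
  rw [Fintype.card_subtype] at h1
  have h2 := Finset.card_filter_add_card_filter_not (s := (Finset.univ : Finset (Fin k))) good
  rw [Finset.card_univ, Fintype.card_fin] at h2
  have h3 : (Finset.univ.filter good).card ≤ S.pat.ee M.card := by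
    convert h1
  omega
end core
end LC

theorem stmt_12 {V : Type*} [Fintype V] [DecidableEq V] (G : SimpleGraph V)
    {x y : V} (X : G.Walk x x) (Y : G.Walk y y)
    (hX : IsLongestCycle G X) (hY : IsLongestCycle G Y)
    (m : ℕ) (hm : (X.support.toFinset ∩ Y.support.toFinset).card = m) (hm1 : 1 ≤ m)
    -- a collection of `k` pairwise vertex-disjoint `(V(X)∖M, V(Y)∖M)`-paths
    (k : ℕ) (a b : Fin k → V) (P : ∀ t, G.Walk (a t) (b t))
    (hP : ∀ t, IsABPath G
      ({v | v ∈ X.support} \ {v | v ∈ Y.support})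
      ({v | v ∈ Y.support} \ {v | v ∈ X.support}) (P t))
    (hdisj : ∀ s t, s ≠ t → ∀ v ∈ (P s).support, v ∉ (P t).support) :
    (k : ℝ) ≤ Real.sqrt 10 * (m : ℝ) ^ ((3 : ℝ) / 2) + (m : ℝ) / 2 := by
  obtain ⟨v, hv⟩ : (X.support.toFinset ∩ Y.support.toFinset).Nonempty :=
    Finset.card_pos.1 (by omega)
  simp only [Finset.mem_inter, List.mem_toFinset] at hv
  have e1 : ∀ u, u ∈ (X.rotate v hv.1).support ↔ u ∈ X.support := fun u =>
    Walk.mem_support_rotate_iff ..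
  have e2 : ∀ u, u ∈ (Y.rotate v hv.2).support ↔ u ∈ Y.support := fun u =>
    Walk.mem_support_rotate_iff ..
  have hXY : Y.length = X.length := le_antisymm (hX.2 _ _ hY.1) (hY.2 _ _ hX.1)
  obtain ⟨e, he, hk⟩ := LC.core (X.rotate v hv.1) (Y.rotate v hv.2)
    ((Walk.isCycle_rotate hv.1).2 hX.1) ((Walk.isCycle_rotate hv.2).2 hY.1)
    (by simpa using hXY) (by simpa using hX.2) k a b P (by simpa only [e1, e2] using hP) hdisj
  have : (X.rotate v hv.1).support.toFinset ∩ (Y.rotate v hv.2).support.toFinset =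
      X.support.toFinset ∩ Y.support.toFinset := by
    ext u; simp only [Finset.mem_inter, List.mem_toFinset, e1, e2]
  rw [this, hm] at he hk
  exact LC.real_final hm1 he hk
end
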